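/- arXiv:2106.12439 — 8 statements merged into one kernel-verified Lean document; each statement's English description precedes it below -/
import Mathlib

section
/- Let 1 < q < ∞. There exist constants 0 < c ≤ C, depending only on q, such that for all real numbers a, b: c·(|a|^{q/2−1}a − |b|^{q/2−1}b)² ≤ (a−b)(|a|^{q−2}a − |b|^{q−2}b) ≤ C·(|a|^{q/2−1}a − |b|^{q/2−1}b)². -/
namespace PointwiseQInequality

lemma one_sub_rpow_le {t α β : ℝ} (ht0 : 0 ≤ t) (ht1 : t ≤ 1) (hα : 0 < α) (hβ : 0 < β) :
    1 - t ^ α ≤ (1 + α / β) * (1 - t ^ β) := by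
  have hB0 : 0 ≤ t ^ β := Real.rpow_nonneg ht0 β
  have hB1 : t ^ β ≤ 1 := Real.rpow_le_one ht0 ht1 hβ.le
  have hK : 0 < α / β := div_pos hα hβ
  rcases le_total β α with h | h
  · have hb := one_add_mul_self_le_rpow_one_add (s := t ^ β - 1) (by linarith)
      ((one_le_div hβ).2 h)
    rw [add_sub_cancel, ← Real.rpow_mul ht0, mul_div_cancel₀ _ hβ.ne'] at hb
    nlinarith
  · have hle : t ^ β ≤ t ^ α := by
      rcases ht0.eq_or_lt with rfl | hpos
      · rw [Real.zero_rpow hα.ne', Real.zero_rpow hβ.ne']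
      · exact Real.rpow_le_rpow_of_exponent_ge hpos ht1 h
    nlinarith [mul_nonneg hK.le (sub_nonneg.2 hB1)]

lemma abs_rpow_mul_self_of_nonneg {t r : ℝ} (ht : 0 ≤ t) (hr : r ≠ 0) :
    |t| ^ (r - 1) * t = t ^ r := by
  rw [abs_of_nonneg ht]
  simpa using (Real.rpow_add_one' ht (y := r - 1) (by simpa using hr)).symm

lemma abs_rpow_mul_mul (r s a : ℝ) :
    |s * a| ^ r * (s * a) = |s| ^ r * s * (|a| ^ r * a) := by
  rw [abs_mul, Real.mul_rpow (abs_nonneg s) (abs_nonneg a)]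
  ring

lemma sq_abs_rpow_mul (q a : ℝ) :
    (|a| ^ (q / 2 - 1) * a) ^ 2 = a * (|a| ^ (q - 2) * a) := by
  have h := Real.rpow_mul_natCast (abs_nonneg a) (q / 2 - 1) 2
  rw [show (q / 2 - 1) * ((2 : ℕ) : ℝ) = q - 2 by push_cast; ring] at h
  rw [mul_pow, ← h]
  ring

lemma bounds_one_of_nonneg {q t : ℝ} (hq : 1 < q) (ht0 : 0 ≤ t) (ht1 : t ≤ 1) :
    (1 - t ^ (q / 2)) ^ 2 ≤
        (1 + q / 2) * (1 + q / 2 / (q - 1)) * ((1 - t) * (1 - t ^ (q - 1))) ∧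
      (1 - t) * (1 - t ^ (q - 1)) ≤ (1 - t ^ (q / 2)) ^ 2 ∧
      (1 + t ^ (q / 2)) ^ 2 ≤ (1 + t) * (1 + t ^ (q - 1)) ∧
      (1 + t) * (1 + t ^ (q - 1)) ≤ 4 * (1 + t ^ (q / 2)) ^ 2 := by
  have hq2 : 0 < q / 2 := by linarith
  have hq1 : 0 < q - 1 := by linarith
  have h1 := one_sub_rpow_le ht0 ht1 hq2 one_pos
  have h2 := one_sub_rpow_le ht0 ht1 hq2 hq1
  rw [Real.rpow_one, div_one] at h1
  have hA0 : 0 ≤ t ^ (q / 2) := Real.rpow_nonneg ht0 _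
  have hA1 : t ^ (q / 2) ≤ 1 := Real.rpow_le_one ht0 ht1 hq2.le
  have hB0 : 0 ≤ t ^ (q - 1) := Real.rpow_nonneg ht0 _
  have hB1 : t ^ (q - 1) ≤ 1 := Real.rpow_le_one ht0 ht1 hq1.le
  have hsq : (t ^ (q / 2)) ^ 2 = t * t ^ (q - 1) := by
    have h := sq_abs_rpow_mul q t
    rwa [abs_rpow_mul_self_of_nonneg ht0 hq2.ne', show q - 2 = q - 1 - 1 by ring,
      abs_rpow_mul_self_of_nonneg ht0 hq1.ne'] at h
  generalize t ^ (q / 2) = A at *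
  generalize t ^ (q - 1) = B at *
  have ham : 2 * A ≤ t + B := by
    refine abs_le_of_sq_le_sq' ?_ (by linarith) |>.2
    nlinarith [sq_nonneg (t - B)]
  refine ⟨?_, by nlinarith, by nlinarith, by nlinarith [mul_nonneg ht0 hB0]⟩
  calc (1 - A) ^ 2 = (1 - A) * (1 - A) := sq _
    _ ≤ ((1 + q / 2) * (1 - t)) * ((1 + q / 2 / (q - 1)) * (1 - B)) :=
      mul_le_mul h1 h2 (by linarith) (by linarith)
    _ = _ := by ring

lemma bounds_one {q s : ℝ} (hq : 1 < q) (hs : |s| ≤ 1) :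
    (1 - |s| ^ (q / 2 - 1) * s) ^ 2 ≤
        (1 + q / 2) * (1 + q / 2 / (q - 1)) * ((1 - s) * (1 - |s| ^ (q - 2) * s)) ∧
      (1 - s) * (1 - |s| ^ (q - 2) * s) ≤ 4 * (1 - |s| ^ (q / 2 - 1) * s) ^ 2 := by
  have hq2 : 0 < q / 2 := by linarith
  have hq1 : 0 < q - 1 := by linarith
  obtain ⟨h1, h2, h3, h4⟩ := bounds_one_of_nonneg hq (abs_nonneg s) hs
  rw [← abs_rpow_mul_self_of_nonneg (abs_nonneg s) hq2.ne',
    ← abs_rpow_mul_self_of_nonneg (abs_nonneg s) hq1.ne', abs_abs,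
    show q - 1 - 1 = q - 2 by ring] at h1 h2 h3 h4
  rcases abs_cases s with ⟨h, -⟩ | ⟨h, -⟩
  · rw [h] at h1 h2 ⊢
    exact ⟨h1, h2.trans (by nlinarith [sq_nonneg (1 - s ^ (q / 2 - 1) * s)])⟩
  · have hs' : s = -|s| := by linarith
    have hK : 1 ≤ (1 + q / 2) * (1 + q / 2 / (q - 1)) :=
      one_le_mul_of_one_le_of_one_le (by linarith) (by linarith [div_pos hq2 hq1])
    generalize |s| = t at *
    subst hs'
    simp only [mul_neg, sub_neg_eq_add]
    exact ⟨h3.trans (le_mul_of_one_le_left ((sq_nonneg _).trans h3) hK), h4⟩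

lemma bounds_of_abs_le {q a b : ℝ} (hq : 1 < q) (hab : |b| ≤ |a|) :
    (|a| ^ (q / 2 - 1) * a - |b| ^ (q / 2 - 1) * b) ^ 2 ≤
        (1 + q / 2) * (1 + q / 2 / (q - 1)) *
          ((a - b) * (|a| ^ (q - 2) * a - |b| ^ (q - 2) * b)) ∧
      (a - b) * (|a| ^ (q - 2) * a - |b| ^ (q - 2) * b) ≤
        4 * (|a| ^ (q / 2 - 1) * a - |b| ^ (q / 2 - 1) * b) ^ 2 := by
  rcases eq_or_ne a 0 with rfl | ha
  · have hb : b = 0 := by simpa using hab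
    simp [hb]
  obtain ⟨s, rfl⟩ : ∃ s, b = s * a := ⟨b / a, (div_mul_cancel₀ b ha).symm⟩
  have hs : |s| ≤ 1 := by
    rw [abs_mul] at hab
    exact le_of_mul_le_mul_right (by linarith) (abs_pos.2 ha)
  obtain ⟨h1, h2⟩ := bounds_one hq hs
  have hsq := sq_abs_rpow_mul q a
  have h0 := sq_nonneg (|a| ^ (q / 2 - 1) * a)
  rw [abs_rpow_mul_mul, abs_rpow_mul_mul]
  have e1 : (|a| ^ (q / 2 - 1) * a - |s| ^ (q / 2 - 1) * s * (|a| ^ (q / 2 - 1) * a)) ^ 2 =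
      (1 - |s| ^ (q / 2 - 1) * s) ^ 2 * (|a| ^ (q / 2 - 1) * a) ^ 2 := by ring
  have e2 : (a - s * a) * (|a| ^ (q - 2) * a - |s| ^ (q - 2) * s * (|a| ^ (q - 2) * a)) =
      (1 - s) * (1 - |s| ^ (q - 2) * s) * (|a| ^ (q / 2 - 1) * a) ^ 2 := by
    rw [hsq]
    ring
  rw [e1, e2]
  exact ⟨(mul_le_mul_of_nonneg_right h1 h0).trans_eq (mul_assoc _ _ _),
    (mul_le_mul_of_nonneg_right h2 h0).trans_eq (mul_assoc _ _ _)⟩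

end PointwiseQInequality

open PointwiseQInequality in
theorem pointwise_q_inequality_two_sided (q : ℝ) (hq : 1 < q) :
    ∃ c C : ℝ, 0 < c ∧ c ≤ C ∧
      ∀ a b : ℝ,
        c * (|a| ^ (q / 2 - 1) * a - |b| ^ (q / 2 - 1) * b) ^ 2 ≤
            (a - b) * (|a| ^ (q - 2) * a - |b| ^ (q - 2) * b) ∧
          (a - b) * (|a| ^ (q - 2) * a - |b| ^ (q - 2) * b) ≤
            C * (|a| ^ (q / 2 - 1) * a - |b| ^ (q / 2 - 1) * b) ^ 2 := by
  have hd : 0 < q / 2 / (q - 1) := div_pos (by linarith) (by linarith)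
  have hK : 1 ≤ (1 + q / 2) * (1 + q / 2 / (q - 1)) :=
    one_le_mul_of_one_le_of_one_le (by linarith) (by linarith)
  have hK0 := one_pos.trans_le hK
  refine ⟨((1 + q / 2) * (1 + q / 2 / (q - 1)))⁻¹, 4, inv_pos.2 hK0,
    (inv_le_one_of_one_le₀ hK).trans (by norm_num), fun a b => ?_⟩
  rw [inv_mul_le_iff₀ hK0]
  rcases le_total |b| |a| with h | h
  · exact bounds_of_abs_le hq h
  · have := bounds_of_abs_le hq h
    rwa [sub_sq_comm, ← neg_sub a b, ← neg_sub (|a| ^ (q - 2) * a), neg_mul_neg] at this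
end

section
/- Let 1 < q < ∞. For all real numbers a, b one has (a−b)(|a|^{q−2}a − |b|^{q−2}b) ≥ (4(q−1)/q²)·(|a|^{q/2−1}a − |b|^{q/2−1}b)². -/
theorem sinh_mul_le_mul_sinh {c y : ℝ} (hc : 0 ≤ c) (hc1 : c ≤ 1) (hy : 0 ≤ y) :
    Real.sinh (c * y) ≤ c * Real.sinh y := by
  have hd (x : ℝ) : HasDerivAt (fun x => c * Real.sinh x - Real.sinh (c * x))
      (c * Real.cosh x - Real.cosh (c * x) * c) x := by
    have h := ((hasDerivAt_id x).const_mul c).sinh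
    simp only [id, mul_one] at h
    exact ((Real.hasDerivAt_sinh x).const_mul c).sub h
  have hmono : MonotoneOn (fun x => c * Real.sinh x - Real.sinh (c * x)) (Set.Ici 0) := by
    refine monotoneOn_of_deriv_nonneg (convex_Ici 0)
      (fun x _ => (hd x).continuousAt.continuousWithinAt)
      (fun x _ => (hd x).differentiableAt.differentiableWithinAt) fun x hx => ?_
    rw [interior_Ici] at hx
    have hx0 : 0 < x := hx
    have hcosh : Real.cosh (c * x) ≤ Real.cosh x := by
      rw [Real.cosh_le_cosh, abs_of_nonneg (mul_nonneg hc hx0.le), abs_of_pos hx0]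
      exact mul_le_of_le_one_left hx0.le hc1
    rw [(hd x).deriv]
    nlinarith
  have h := hmono Set.self_mem_Ici hy hy
  simp only [mul_zero, Real.sinh_zero, sub_zero] at h
  linarith

theorem sinh_mul_sq_le {c : ℝ} (hc : |c| ≤ 1) (y : ℝ) :
    Real.sinh (c * y) ^ 2 ≤ c ^ 2 * Real.sinh y ^ 2 := by
  have h := sinh_mul_le_mul_sinh (abs_nonneg c) hc (abs_nonneg y)
  rw [← abs_mul, ← Real.abs_sinh, ← Real.abs_sinh, ← abs_mul] at h
  rw [← mul_pow]
  exact sq_le_sq.mpr h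

theorem exp_sub_exp_eq_sinh (x y : ℝ) :
    Real.exp x - Real.exp y = 2 * Real.exp ((x + y) / 2) * Real.sinh ((x - y) / 2) := by
  have hx : Real.exp x = Real.exp ((x + y) / 2) * Real.exp ((x - y) / 2) := by
    rw [← Real.exp_add]; ring_nf
  have hy : Real.exp y = Real.exp ((x + y) / 2) * Real.exp (-((x - y) / 2)) := by
    rw [← Real.exp_add]; ring_nf
  rw [Real.sinh_eq, hx, hy]
  ring

theorem abs_exp_rpow_mul_exp (r s : ℝ) :
    |Real.exp s| ^ r * Real.exp s = Real.exp (s * (r + 1)) := by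
  rw [Real.abs_exp, ← Real.exp_mul, ← Real.exp_add]
  ring_nf

theorem sharp_constant_le_one {q : ℝ} (hq : 1 < q) : 4 * (q - 1) / q ^ 2 ≤ 1 := by
  rw [div_le_one (by positivity)]
  nlinarith [sq_nonneg (q - 2)]

theorem exp_mul_exp_eq_sq (q s : ℝ) :
    Real.exp s * Real.exp (s * (q - 2 + 1)) = Real.exp (s * (q / 2 - 1 + 1)) ^ 2 := by
  rw [← Real.exp_add, sq, ← Real.exp_add]
  ring_nf

theorem exp_cross_terms (q s t : ℝ) :
    2 * (Real.exp (s * (q / 2 - 1 + 1)) * Real.exp (t * (q / 2 - 1 + 1))) +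
        (Real.exp ((t + s * (q - 1)) / 2) - Real.exp ((s + t * (q - 1)) / 2)) ^ 2 =
      Real.exp t * Real.exp (s * (q - 2 + 1)) + Real.exp s * Real.exp (t * (q - 2 + 1)) := by
  rw [sub_sq, sq, sq, mul_assoc 2 (Real.exp _) (Real.exp _)]
  simp only [← Real.exp_add]
  ring_nf

theorem q_inequality_exp {q : ℝ} (hq : 1 < q) (s t : ℝ) :
    4 * (q - 1) / q ^ 2 *
        (Real.exp (s * (q / 2 - 1 + 1)) - Real.exp (t * (q / 2 - 1 + 1))) ^ 2 ≤
      (Real.exp s - Real.exp t) *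
        (Real.exp (s * (q - 2 + 1)) - Real.exp (t * (q - 2 + 1))) := by
  have hq0 : q ≠ 0 := by positivity
  have hc : |(q - 2) / q| ≤ 1 := by
    rw [abs_div, abs_of_pos (by linarith : 0 < q), div_le_one (by linarith), abs_le]
    constructor <;> linarith
  have hcross : (Real.exp ((t + s * (q - 1)) / 2) - Real.exp ((s + t * (q - 1)) / 2)) ^ 2 ≤
      ((q - 2) / q) ^ 2 *
        (Real.exp (s * (q / 2 - 1 + 1)) - Real.exp (t * (q / 2 - 1 + 1))) ^ 2 := by
    rw [exp_sub_exp_eq_sinh, exp_sub_exp_eq_sinh]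
    have hmid : ((t + s * (q - 1)) / 2 + (s + t * (q - 1)) / 2) / 2 =
        (s * (q / 2 - 1 + 1) + t * (q / 2 - 1 + 1)) / 2 := by ring
    have hdiff : ((t + s * (q - 1)) / 2 - (s + t * (q - 1)) / 2) / 2 =
        (q - 2) / q * ((s * (q / 2 - 1 + 1) - t * (q / 2 - 1 + 1)) / 2) := by
      field_simp
      ring
    rw [hmid, hdiff, mul_pow, mul_pow (2 * _), mul_left_comm]
    exact mul_le_mul_of_nonneg_left (sinh_mul_sq_le hc _) (sq_nonneg _)
  have hK : 4 * (q - 1) / q ^ 2 = 1 - ((q - 2) / q) ^ 2 := by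
    field_simp
    ring
  rw [hK]
  linarith [exp_cross_terms q s t, exp_mul_exp_eq_sq q s, exp_mul_exp_eq_sq q t]

theorem q_inequality_exp_add {q : ℝ} (hq : 1 < q) (s t : ℝ) :
    4 * (q - 1) / q ^ 2 *
        (Real.exp (s * (q / 2 - 1 + 1)) + Real.exp (t * (q / 2 - 1 + 1))) ^ 2 ≤
      (Real.exp s + Real.exp t) *
        (Real.exp (s * (q - 2 + 1)) + Real.exp (t * (q - 2 + 1))) := by
  refine (mul_le_of_le_one_left (sq_nonneg _) (sharp_constant_le_one hq)).trans ?_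
  linarith [exp_cross_terms q s t, exp_mul_exp_eq_sq q s, exp_mul_exp_eq_sq q t,
    sq_nonneg (Real.exp ((t + s * (q - 1)) / 2) - Real.exp ((s + t * (q - 1)) / 2))]

theorem q_inequality_exp_zero {q : ℝ} (hq : 1 < q) (s : ℝ) :
    4 * (q - 1) / q ^ 2 * Real.exp (s * (q / 2 - 1 + 1)) ^ 2 ≤
      Real.exp s * Real.exp (s * (q - 2 + 1)) := by
  rw [exp_mul_exp_eq_sq]
  exact mul_le_of_le_one_left (sq_nonneg _) (sharp_constant_le_one hq)

theorem eq_zero_or_exp_or_neg_exp (a : ℝ) :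
    a = 0 ∨ (∃ s, a = Real.exp s) ∨ ∃ s, a = -Real.exp s := by
  rcases lt_trichotomy a 0 with h | h | h
  · exact .inr (.inr ⟨Real.log (-a), by rw [Real.exp_log (neg_pos.mpr h), neg_neg]⟩)
  · exact .inl h
  · exact .inr (.inl ⟨Real.log a, (Real.exp_log h).symm⟩)

theorem pointwise_q_inequality_sharp_constant (q : ℝ) (hq : 1 < q) (a b : ℝ) :
    4 * (q - 1) / q ^ 2 * (|a| ^ (q / 2 - 1) * a - |b| ^ (q / 2 - 1) * b) ^ 2 ≤
      (a - b) * (|a| ^ (q - 2) * a - |b| ^ (q - 2) * b) := by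
  rcases eq_zero_or_exp_or_neg_exp a with rfl | ⟨s, rfl⟩ | ⟨s, rfl⟩ <;>
  rcases eq_zero_or_exp_or_neg_exp b with rfl | ⟨t, rfl⟩ | ⟨t, rfl⟩ <;>
  simp only [abs_neg, mul_neg, abs_exp_rpow_mul_exp, mul_zero, zero_sub, sub_zero, neg_neg,
    sub_neg_eq_add, neg_sq, neg_mul, zero_add]
  · simp
  · exact q_inequality_exp_zero hq t
  · exact q_inequality_exp_zero hq t
  · exact q_inequality_exp_zero hq s
  · exact q_inequality_exp hq s t
  · exact q_inequality_exp_add hq s t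
  · exact q_inequality_exp_zero hq s
  · linarith [q_inequality_exp_add hq s t]
  · linarith [q_inequality_exp hq s t]
end

section
/- For every t ∈ (0,1) and every η ∈ [0, 1/2], one has (t^η − t^{1−η})/(1 − t) ≤ 1 − 2η. -/
theorem Real.convexOn_sinh_Ici : ConvexOn ℝ (Set.Ici 0) Real.sinh := by
  refine MonotoneOn.convexOn_of_deriv (convex_Ici 0) Real.continuous_sinh.continuousOn
    Real.differentiable_sinh.differentiableOn ?_
  rw [Real.deriv_sinh]
  exact Real.cosh_strictMonoOn.monotoneOn.mono interior_subset

theorem Real.sinh_mul_le_mul_sinh {a s : ℝ} (ha0 : 0 ≤ a) (ha1 : a ≤ 1) (hs : 0 ≤ s) :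
    Real.sinh (a * s) ≤ a * Real.sinh s := by
  simpa using Real.convexOn_sinh_Ici.2 (Set.mem_Ici.2 hs) (Set.mem_Ici.2 le_rfl) ha0
    (sub_nonneg.2 ha1) (add_sub_cancel a 1)

theorem rpow_ratio_le_one_sub_two_eta (t η : ℝ) (ht0 : 0 < t) (ht1 : t < 1)
    (hη0 : 0 ≤ η) (hη : η ≤ 1 / 2) :
    (t ^ η - t ^ (1 - η)) / (1 - t) ≤ 1 - 2 * η := by
  rw [div_le_iff₀ (sub_pos.2 ht1)]
  obtain ⟨s, rfl⟩ : ∃ s, t = Real.exp (-2 * s) :=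
    ⟨-Real.log t / 2, by rw [show -2 * (-Real.log t / 2) = Real.log t by ring, Real.exp_log ht0]⟩
  have hs : 0 ≤ s := by linarith [Real.exp_lt_one_iff.1 ht1]
  have h := Real.sinh_mul_le_mul_sinh (a := 1 - 2 * η) (by linarith) (by linarith) hs
  have key (b : ℝ) : 2 * Real.exp (-s) * Real.sinh b = Real.exp (b - s) - Real.exp (-b - s) := by
    rw [Real.sinh_eq, sub_eq_add_neg b, sub_eq_add_neg (-b), Real.exp_add, Real.exp_add]
    ring
  have h' := mul_le_mul_of_nonneg_left h (by positivity : 0 ≤ 2 * Real.exp (-s))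
  rw [key, mul_left_comm, key, sub_self, Real.exp_zero] at h'
  rw [← Real.exp_mul, ← Real.exp_mul]
  convert h' using 4 <;> ring
end

section
/- Let 0 < γ < 1. There exists a constant c = c(γ) > 0 such that for all x > 0: c·min(x^γ, 1) ≤ 1 + x^γ − (1+x)^γ ≤ min(x^γ, 1). -/
theorem one_add_rpow_le_one_add_mul_rpow {γ x : ℝ} (hγ0 : 0 ≤ γ) (hγ1 : γ ≤ 1)
    (hx0 : 0 < x) (hx1 : x ≤ 1) : (1 + x) ^ γ ≤ 1 + γ * x ^ γ := by
  have hbern : (1 + x) ^ γ ≤ 1 + γ * x :=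
    rpow_one_add_le_one_add_mul_self (by linarith) hγ0 hγ1
  have hpow : x ≤ x ^ γ := by
    simpa using Real.rpow_le_rpow_of_exponent_ge hx0 hx1 hγ1
  exact hbern.trans (by gcongr)

theorem one_add_rpow_le_rpow_add {γ x : ℝ} (hγ0 : 0 ≤ γ) (hγ1 : γ ≤ 1) (hx : 1 ≤ x) :
    (1 + x) ^ γ ≤ x ^ γ + γ := by
  have hx0 : 0 < x := by linarith
  have hpos : 0 < x ^ γ := Real.rpow_pos_of_pos hx0 γ
  calc (1 + x) ^ γ = (x * (1 + x⁻¹)) ^ γ := by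
        congr 1
        field_simp
        ring
    _ = x ^ γ * (1 + x⁻¹) ^ γ := Real.mul_rpow hx0.le (by positivity)
    _ ≤ x ^ γ * (1 + γ * x⁻¹ ^ γ) := by
        gcongr
        exact one_add_rpow_le_one_add_mul_rpow hγ0 hγ1 (by positivity) (inv_le_one_of_one_le₀ hx)
    _ = x ^ γ + γ := by
        rw [Real.inv_rpow hx0.le]
        field_simp

theorem rpow_subadditivity_defect_comparable (γ : ℝ) (hγ0 : 0 < γ) (hγ1 : γ < 1) :
    ∃ c : ℝ, 0 < c ∧ ∀ x : ℝ, 0 < x →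
      c * min (x ^ γ) 1 ≤ 1 + x ^ γ - (1 + x) ^ γ ∧
        1 + x ^ γ - (1 + x) ^ γ ≤ min (x ^ γ) 1 := by
  refine ⟨1 - γ, by linarith, fun x hx => ⟨?_, le_min ?_ ?_⟩⟩
  · rcases le_total x 1 with h | h
    · have hdefect := one_add_rpow_le_one_add_mul_rpow hγ0.le hγ1.le hx h
      rw [min_eq_left (Real.rpow_le_one hx.le h hγ0.le)]
      linarith
    · have hdefect := one_add_rpow_le_rpow_add hγ0.le hγ1.le h
      rw [min_eq_right (Real.one_le_rpow h hγ0.le)]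
      linarith
  · have hone : 1 ≤ (1 + x) ^ γ := Real.one_le_rpow (by linarith) hγ0.le
    linarith
  · have hmono : x ^ γ ≤ (1 + x) ^ γ := Real.rpow_le_rpow hx.le (by linarith) hγ0.le
    linarith
end

section
/- Let n ≥ 1 and 0 < γ < 2. There exists a constant c₂ > 0 depending only on (γ, n) such that for every j ∈ ℤ and every real-valued f ∈ L¹(ℝⁿ) whose Fourier transform f̂ is supported in the annulus {ξ : 2^{j−1} ≤ |ξ| ≤ (7/6)·2^j}: writing |∇|^γ f for the inverse Fourier transform of ξ ↦ |ξ|^γ f̂(ξ), one has ∫_{ℝⁿ} (|∇|^γ f)(x) · sgn(f(x)) dx ≥ c₂ · 2^{jγ} · ‖f‖_{L¹}. -/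
open MeasureTheory
open scoped RealInnerProductSpace
open Module Real FourierTransform

section LevyKernel

variable {V : Type*} [NormedAddCommGroup V] [InnerProductSpace ℝ V] [FiniteDimensional ℝ V]
  [MeasurableSpace V] [BorelSpace V]

/-- The kernel `‖y‖ ^ (-(n + γ))`, where `n` is the dimension, of the fractional Laplacian. -/
noncomputable def levyKernel (γ : ℝ) (y : V) : ℝ := ‖y‖ ^ (-(finrank ℝ V + γ))

omit [FiniteDimensional ℝ V] [MeasurableSpace V] [BorelSpace V] in
lemma levyKernel_nonneg (γ : ℝ) (y : V) : 0 ≤ levyKernel γ y := by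
  unfold levyKernel; positivity

omit [FiniteDimensional ℝ V] in
lemma measurable_levyKernel (γ : ℝ) : Measurable (levyKernel γ : V → ℝ) := by
  unfold levyKernel; fun_prop

lemma integrable_min_mul_levyKernel [Nontrivial V] {γ : ℝ} (hγ0 : 0 < γ) (hγ2 : γ < 2) :
    Integrable (fun y : V ↦ min 1 (‖y‖ ^ 2) * levyKernel γ y) := by
  unfold levyKernel
  have hn : 0 < finrank ℝ V := finrank_pos
  set n := finrank ℝ V with hn'
  have := integrable_fun_norm_addHaar (volume : Measure V)
    (f := fun t : ℝ ↦ min 1 (t ^ 2) * t ^ (-(n + γ)))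
  refine this.2 ?_
  rw [← Set.Ioc_union_Ioi_eq_Ioi zero_le_one]
  have hpow : ∀ t : ℝ, 0 < t → t ^ (n - 1) = t ^ ((n : ℝ) - 1) := by
    intro t ht
    rw [← rpow_natCast, Nat.cast_sub hn, Nat.cast_one]
  refine IntegrableOn.union ?_ ?_
  · have h : IntegrableOn (fun t : ℝ ↦ t ^ (1 - γ)) (Set.Ioc 0 1) :=
      (intervalIntegrable_iff_integrableOn_Ioc_of_le zero_le_one).1
        (intervalIntegral.intervalIntegrable_rpow' (by linarith))
    refine h.congr_fun (fun t ht ↦ ?_) measurableSet_Ioc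
    have h1 : t ^ 2 ≤ 1 := pow_le_one₀ ht.1.le ht.2
    simp only [smul_eq_mul, min_eq_right h1]
    rw [← hn', hpow t ht.1, ← rpow_natCast t 2, ← rpow_add ht.1, ← rpow_add ht.1]
    congr 1; push_cast; ring
  · have h : IntegrableOn (fun t : ℝ ↦ t ^ (-1 - γ)) (Set.Ioi 1) :=
      integrableOn_Ioi_rpow_of_lt (by linarith) one_pos
    refine h.congr_fun (fun t (ht : 1 < t) ↦ ?_) measurableSet_Ioi
    have h0 : 0 < t := by linarith
    have h1 : 1 ≤ t ^ 2 := one_le_pow₀ ht.le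
    simp only [smul_eq_mul, min_eq_left h1]
    rw [← hn', hpow t h0, one_mul, ← rpow_add h0]
    congr 1; ring

omit [FiniteDimensional ℝ V] [MeasurableSpace V] [BorelSpace V] in
lemma one_sub_cos_le_min (ξ y : V) {M : ℝ} (hM : ‖ξ‖ ≤ M) :
    1 - cos (2 * π * ⟪y, ξ⟫) ≤ (2 + (2 * π * M) ^ 2) * min 1 (‖y‖ ^ 2) := by
  have hM0 : 0 ≤ M := (norm_nonneg _).trans hM
  have h1 : 1 - cos (2 * π * ⟪y, ξ⟫) ≤ 2 := by linarith [neg_one_le_cos (2 * π * ⟪y, ξ⟫)]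
  have h2 : 1 - cos (2 * π * ⟪y, ξ⟫) ≤ (2 * π * M) ^ 2 * ‖y‖ ^ 2 := by
    have h3 := one_sub_sq_div_two_le_cos (x := 2 * π * ⟪y, ξ⟫)
    have h4 : |⟪y, ξ⟫| ≤ ‖y‖ * M :=
      (abs_real_inner_le_norm y ξ).trans (by gcongr)
    have h5 : ⟪y, ξ⟫ ^ 2 ≤ (‖y‖ * M) ^ 2 := sq_le_sq' (by linarith [abs_le.1 h4]) (abs_le.1 h4).2
    nlinarith [mul_le_mul_of_nonneg_left h5 (sq_nonneg (2 * π)), sq_nonneg (2 * π * ⟪y, ξ⟫)]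
  rcases le_total 1 (‖y‖ ^ 2) with h | h
  · rw [min_eq_left h]; nlinarith [sq_nonneg (2 * π * M)]
  · rw [min_eq_right h]; nlinarith [sq_nonneg ‖y‖]

lemma integrable_one_sub_cos_mul_levyKernel [Nontrivial V] {γ : ℝ} (hγ0 : 0 < γ) (hγ2 : γ < 2)
    (ξ : V) : Integrable (fun y : V ↦ (1 - cos (2 * π * ⟪y, ξ⟫)) * levyKernel γ y) := by
  refine ((integrable_min_mul_levyKernel hγ0 hγ2).const_mul (2 + (2 * π * ‖ξ‖) ^ 2)).mono' ?_ ?_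
  · exact ((by fun_prop : Measurable fun y : V ↦ 1 - cos (2 * π * ⟪y, ξ⟫)).mul
      (measurable_levyKernel γ)).aestronglyMeasurable
  · refine .of_forall fun y ↦ ?_
    rw [norm_of_nonneg (mul_nonneg (by linarith [cos_le_one (2 * π * ⟪y, ξ⟫)])
      (levyKernel_nonneg γ y)), ← mul_assoc]
    exact mul_le_mul_of_nonneg_right (one_sub_cos_le_min ξ y le_rfl) (levyKernel_nonneg γ y)

omit [FiniteDimensional ℝ V] [MeasurableSpace V] [BorelSpace V] in
lemma levyKernel_smul (γ : ℝ) {t : ℝ} (ht : 0 < t) (y : V) :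
    levyKernel γ (t • y) = t ^ (-(finrank ℝ V + γ)) * levyKernel γ y := by
  unfold levyKernel
  rw [norm_smul, norm_of_nonneg ht.le, mul_rpow ht.le (norm_nonneg _)]

/-- The Lévy–Khintchine representation of `‖ξ‖ ^ γ`. -/
lemma exists_integral_one_sub_cos_mul_levyKernel [Nontrivial V] {γ : ℝ} (hγ0 : 0 < γ)
    (hγ2 : γ < 2) : ∃ C : ℝ, 0 < C ∧ ∀ ξ : V,
      ∫ y : V, (1 - cos (2 * π * ⟪y, ξ⟫)) * levyKernel γ y = C * ‖ξ‖ ^ γ := by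
  obtain ⟨e, he⟩ := exists_norm_eq V zero_le_one
  set J : V → ℝ := fun ξ ↦ ∫ y : V, (1 - cos (2 * π * ⟪y, ξ⟫)) * levyKernel γ y with hJ
  have hiso : ∀ ξ η : V, ‖ξ‖ = ‖η‖ → J ξ = J η := by
    intro ξ η h
    set A := (ℝ ∙ (ξ - η))ᗮ.reflection
    have hA : A ξ = η := Submodule.reflection_sub h
    symm
    simp only [hJ]
    rw [← MeasurePreserving.integral_comp A.measurePreserving
      A.toHomeomorph.measurableEmbedding]
    congr 1 with y
    rw [← hA, A.inner_map_map]
    simp [levyKernel]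
  have hscale : ∀ t : ℝ, 0 < t → J (t • e) = t ^ γ * J e := by
    intro t ht
    have h1 := Measure.integral_comp_smul (volume : Measure V)
      (fun y : V ↦ (1 - cos (2 * π * ⟪y, e⟫)) * levyKernel γ y) t
    have h2 : ∀ y : V, (1 - cos (2 * π * ⟪t • y, e⟫)) * levyKernel γ (t • y) =
        t ^ (-(finrank ℝ V + γ)) * ((1 - cos (2 * π * ⟪y, t • e⟫)) * levyKernel γ y) := by
      intro y
      rw [levyKernel_smul γ ht, real_inner_smul_left, real_inner_smul_right]; ring
    simp_rw [h2, integral_const_mul] at h1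
    change t ^ (-(finrank ℝ V + γ)) * J (t • e) = |(t ^ finrank ℝ V)⁻¹| • J e at h1
    rw [abs_of_nonneg (by positivity), smul_eq_mul, ← rpow_natCast, ← rpow_neg ht.le] at h1
    have h3 : t ^ ((finrank ℝ V : ℝ) + γ) * t ^ (-(finrank ℝ V + γ)) = 1 := by
      rw [← rpow_add ht]; simp
    calc J (t • e) = t ^ ((finrank ℝ V : ℝ) + γ) * (t ^ (-(finrank ℝ V + γ)) * J (t • e)) := by
          rw [← mul_assoc, h3, one_mul]
      _ = t ^ γ * J e := by
          rw [h1, ← mul_assoc, ← rpow_add ht]; congr 2; ring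
  refine ⟨J e, ?_, fun ξ ↦ ?_⟩
  · refine (integral_pos_iff_support_of_nonneg (fun y ↦ ?_)
      (integrable_one_sub_cos_mul_levyKernel hγ0 hγ2 e)).2 ?_
    · exact mul_nonneg (by linarith [cos_le_one (2 * π * ⟪y, e⟫)]) (levyKernel_nonneg γ y)
    · have hopen : IsOpen {y : V | y ≠ 0 ∧ cos (2 * π * ⟪y, e⟫) < 1} :=
        isOpen_ne.inter (isOpen_lt (f := fun y : V ↦ cos (2 * π * ⟪y, e⟫)) (by fun_prop)
          continuous_const)
      have hne : {y : V | y ≠ 0 ∧ cos (2 * π * ⟪y, e⟫) < 1}.Nonempty := by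
        refine ⟨(1 / 2 : ℝ) • e, ?_, ?_⟩
        · intro h
          rw [smul_eq_zero] at h
          rcases h with h | h
          · norm_num at h
          · simp [h] at he
        · rw [real_inner_smul_left, real_inner_self_eq_norm_sq, he]
          have : 2 * π * (1 / 2 * 1 ^ 2) = π := by ring
          rw [this, cos_pi]; norm_num
      refine (hopen.measure_pos volume hne).trans_le (measure_mono ?_)
      rintro y ⟨hy, hy'⟩
      have h1 : 0 < levyKernel γ y := rpow_pos_of_pos (norm_pos_iff.2 hy) _
      exact (mul_pos (by linarith) h1).ne'
  · change J ξ = J e * ‖ξ‖ ^ γ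
    rcases eq_or_ne ξ 0 with rfl | h
    · simp [hJ, zero_rpow hγ0.ne']
    · rw [hiso ξ (‖ξ‖ • e) (by rw [norm_smul, he]; simp), hscale _ (norm_pos_iff.2 h), mul_comm]

end LevyKernel

section Fourier

open scoped SchwartzMap ContDiff ComplexConjugate

variable {V : Type*} [NormedAddCommGroup V] [InnerProductSpace ℝ V] [FiniteDimensional ℝ V]
  [MeasurableSpace V] [BorelSpace V]

lemma integral_fourier_mul_eq_integral_mul_fourier {f g : V → ℂ} (hf : Integrable f)
    (hg : Integrable g) : ∫ ξ, 𝓕 f ξ * g ξ = ∫ x, f x * 𝓕 g x := by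
  have h := VectorFourier.integral_fourierIntegral_smul_eq_flip (L := innerₗ V)
    Real.continuous_fourierChar continuous_inner hf hg
  rw [flip_innerₗ] at h
  exact h

lemma integral_fourierInv_mul_eq_integral_mul_fourierInv {f g : V → ℂ} (hf : Integrable f)
    (hg : Integrable g) : ∫ ξ, 𝓕⁻ f ξ * g ξ = ∫ x, f x * 𝓕⁻ g x := by
  rw [fourierInv_eq_fourier_comp_neg f,
    integral_fourier_mul_eq_integral_mul_fourier hf.comp_neg hg,
    ← integral_neg_eq_self (fun x ↦ f x * 𝓕⁻ g x)]
  simp [fourierInv_eq_fourier_neg]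

lemma continuous_fourier {f : V → ℂ} (hf : Integrable f) : Continuous (𝓕 f) :=
  VectorFourier.fourierIntegral_continuous Real.continuous_fourierChar continuous_inner hf

lemma continuous_fourierInv {f : V → ℂ} (hf : Integrable f) : Continuous (𝓕⁻ f) := by
  rw [fourierInv_eq_fourier_comp_neg]
  exact continuous_fourier hf.comp_neg

lemma fourierInv_fourier_ae_eq {f : V → ℂ} (hf : Integrable f) (hf' : Integrable (𝓕 f)) :
    𝓕⁻ (𝓕 f) =ᵐ[volume] f := by
  refine ae_eq_of_integral_contDiff_smul_eq (continuous_fourierInv hf').locallyIntegrable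
    hf.locallyIntegrable fun g hg hg' ↦ ?_
  have hc : HasCompactSupport (fun x ↦ (g x : ℂ)) := hg'.comp_left Complex.ofReal_zero
  set G : 𝓢(V, ℂ) := hc.toSchwartzMap (Complex.ofRealCLM.contDiff.comp hg)
  have hG : ∀ x, (g x : ℂ) = G x := fun x ↦ rfl
  simp only [Complex.real_smul, hG]
  calc ∫ x, G x * 𝓕⁻ (𝓕 f) x = ∫ x, 𝓕⁻ (G : V → ℂ) x * 𝓕 f x :=
        (integral_fourierInv_mul_eq_integral_mul_fourierInv G.integrable hf').symm
    _ = ∫ x, 𝓕 f x * 𝓕⁻ G x := by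
        simp_rw [SchwartzMap.fourierInv_coe, mul_comm]
    _ = ∫ x, f x * 𝓕 (𝓕⁻ G : 𝓢(V, ℂ)) x := by
        rw [integral_fourier_mul_eq_integral_mul_fourier hf (𝓕⁻ G).integrable,
          SchwartzMap.fourier_coe]
    _ = ∫ x, G x * f x := by
        simp_rw [FourierTransform.fourier_fourierInv_eq, mul_comm]

lemma integral_mul_fourierInv_sub {u k : V → ℂ} (hu : Integrable u) (hk : Integrable k) (x : V) :
    ∫ y, k y * 𝓕⁻ u (x - y) = 𝓕⁻ (fun η ↦ u η * 𝓕 k η) x := by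
  have hux : Integrable (fun η ↦ 𝐞 ⟪η, x⟫ • u η) := by
    simpa using (Real.fourierIntegral_convergent_iff (μ := volume) (f := u) (-x)).2 hu
  have h1 : ∀ y, 𝓕⁻ u (x - y) = 𝓕 (fun η ↦ 𝐞 ⟪η, x⟫ • u η) y := by
    intro y
    rw [fourierInv_eq, fourier_eq]
    congr 1 with η
    rw [smul_smul, ← AddChar.map_add_eq_mul, inner_sub_right]
    congr 2; ring
  simp_rw [h1, mul_comm (k _)]
  rw [integral_fourier_mul_eq_integral_mul_fourier hux hk, fourierInv_eq]
  simp_rw [smul_mul_assoc]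

lemma exists_schwartzMap_fourier_eq_one (ρ : ℝ) :
    ∃ ψ : 𝓢(V, ℂ), ∀ η, ‖η‖ ≤ ρ → 𝓕 (ψ : V → ℂ) η = 1 := by
  let φ : ContDiffBump (0 : V) := ⟨|ρ| + 1, |ρ| + 2, by positivity, by linarith⟩
  have hc : HasCompactSupport (fun x ↦ (φ x : ℂ)) :=
    φ.hasCompactSupport.comp_left Complex.ofReal_zero
  set Φ : 𝓢(V, ℂ) := hc.toSchwartzMap (Complex.ofRealCLM.contDiff.comp φ.contDiff)
  refine ⟨𝓕⁻ Φ, fun η hη ↦ ?_⟩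
  rw [← SchwartzMap.fourier_coe, FourierTransform.fourier_fourierInv_eq]
  change ((φ η : ℝ) : ℂ) = 1
  rw [φ.one_of_mem_closedBall]; · simp
  rw [mem_closedBall_zero_iff]
  change ‖η‖ ≤ |ρ| + 1
  linarith [le_abs_self ρ]

lemma fourier_conj (f : V → ℂ) (η : V) : 𝓕 (fun x ↦ conj (f x)) η = conj (𝓕⁻ f η) := by
  rw [fourier_eq', fourierInv_eq', ← integral_conj]
  congr 1 with x
  rw [smul_eq_mul, smul_eq_mul, map_mul, ← Complex.exp_conj, map_mul, Complex.conj_I,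
    Complex.conj_ofReal]
  congr 2; push_cast; ring

/-- A nonnegative band-limited function below the kernel of the fractional Laplacian. -/
lemma exists_bandLimited_le_levyKernel {γ : ℝ} (hγ0 : 0 < γ) (hγ2 : γ < 2) :
    ∃ k : V → ℝ, (∀ y, 0 ≤ k y) ∧ Integrable k ∧ 0 < ∫ y, k y ∧
      (∀ y, y ≠ 0 → k y ≤ levyKernel γ y) ∧
      ∀ ξ, 1 ≤ ‖ξ‖ → 𝓕 (fun y ↦ (k y : ℂ)) ξ = 0 := by
  let φ : ContDiffBump (0 : V) := ⟨1 / 4, 1 / 2, by norm_num, by norm_num⟩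
  have hφ : ∀ x, 1 / 2 ≤ ‖x‖ → φ x = 0 := fun x hx ↦
    φ.zero_of_le_dist (by rw [dist_zero_right]; exact hx)
  have hc : HasCompactSupport (fun x ↦ (φ x : ℂ)) :=
    φ.hasCompactSupport.comp_left Complex.ofReal_zero
  set Φ : 𝓢(V, ℂ) := hc.toSchwartzMap (Complex.ofRealCLM.contDiff.comp φ.contDiff)
  have hΦ : ∀ x, Φ x = (φ x : ℂ) := fun x ↦ rfl
  set θ : 𝓢(V, ℂ) := 𝓕⁻ Φ with hθ
  have hθΦ : 𝓕 (θ : V → ℂ) = Φ := by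
    rw [← SchwartzMap.fourier_coe, hθ, FourierTransform.fourier_fourierInv_eq]
  have hθint : Integrable (fun y ↦ ‖θ y‖ ^ 2) := (θ.memLp 2).integrable_norm_pow (by norm_num)
  have hθpos : 0 < ∫ y, ‖θ y‖ ^ 2 := by
    refine (integral_pos_iff_support_of_nonneg (fun y ↦ by positivity) hθint).2 ?_
    have hcont : Continuous (fun y ↦ ‖θ y‖ ^ 2) := by fun_prop
    refine hcont.isOpen_support.measure_pos volume ?_
    by_contra hne
    have h0 : (θ : V → ℂ) = 0 := by
      rw [Set.not_nonempty_iff_eq_empty, Function.support_eq_empty_iff] at hne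
      ext y
      simpa using congrFun hne y
    have h1 : Φ 0 = 0 := by
      rw [← hθΦ, h0, fourier_eq]; simp
    rw [hΦ, φ.one_of_mem_closedBall (by simpa using φ.rIn_pos.le)] at h1
    simp at h1
  obtain ⟨C, hC⟩ : ∃ C : ℝ, ∀ y, (1 + ‖y‖) ^ (finrank ℝ V + 2) * ‖θ y‖ ≤ C := by
    have h := SchwartzMap.one_add_le_sup_seminorm_apply (𝕜 := ℂ) (m := (finrank ℝ V + 2, 0))
      le_rfl le_rfl θ
    simp only [norm_iteratedFDeriv_zero] at h
    exact ⟨_, h⟩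
  have hC0 : 0 ≤ C := (by positivity : (0 : ℝ) ≤ _).trans (hC 0)
  have hbound : ∀ y, y ≠ 0 → ‖θ y‖ ^ 2 ≤ (C ^ 2 + 1) * levyKernel γ y := by
    intro y hy
    have hy' : 0 < ‖y‖ := norm_pos_iff.2 hy
    have h1 : ‖θ y‖ ≤ C := by
      refine le_trans ?_ (hC y)
      exact le_mul_of_one_le_left (norm_nonneg _) (one_le_pow₀ (by linarith))
    have h2 : ‖y‖ ^ ((finrank ℝ V : ℝ) + γ) ≤ (1 + ‖y‖) ^ (finrank ℝ V + 2) := by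
      rw [← rpow_natCast]
      refine (rpow_le_rpow hy'.le (by linarith) (by positivity)).trans
        (rpow_le_rpow_of_exponent_le (by linarith) ?_)
      push_cast; linarith
    have h3 : ‖y‖ ^ ((finrank ℝ V : ℝ) + γ) * ‖θ y‖ ^ 2 ≤ C ^ 2 + 1 := by
      calc _ ≤ (1 + ‖y‖) ^ (finrank ℝ V + 2) * ‖θ y‖ ^ 2 := by gcongr
        _ = ((1 + ‖y‖) ^ (finrank ℝ V + 2) * ‖θ y‖) * ‖θ y‖ := by ring
        _ ≤ C * C := by gcongr; exact hC y
        _ ≤ _ := by linarith [sq C]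
    rw [levyKernel, rpow_neg hy'.le, ← div_eq_mul_inv, le_div_iff₀ (by positivity), mul_comm]
    exact h3
  have hD : 0 < (C ^ 2 + 1)⁻¹ := by positivity
  refine ⟨fun y ↦ (C ^ 2 + 1)⁻¹ * ‖θ y‖ ^ 2, fun y ↦ by positivity, hθint.const_mul _, ?_, ?_, ?_⟩
  · rw [integral_const_mul]; positivity
  · intro y hy
    rw [inv_mul_le_iff₀ (by positivity)]
    exact hbound y hy
  · intro ξ hξ
    have hΦneg : Integrable (fun η ↦ Φ (-η)) := Φ.integrable.comp_neg
    have hθξ : Integrable (fun y ↦ 𝐞 (-⟪y, ξ⟫) • conj (θ y)) :=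
      (Real.fourierIntegral_convergent_iff (μ := volume) ξ).2
        (Complex.conjCLE.toContinuousLinearMap.integrable_comp θ.integrable)
    have h1 : ∀ y, θ y = 𝓕 (fun η ↦ Φ (-η)) y := by
      intro y
      rw [hθ, SchwartzMap.fourierInv_coe, fourierInv_eq_fourier_comp_neg]
    have h2 : ∀ η, 𝓕 (fun y ↦ 𝐞 (-⟪y, ξ⟫) • conj (θ y)) η = conj (Φ (-(η + ξ))) := by
      intro η
      rw [← hθΦ, ← fourierInv_eq_fourier_neg, ← fourier_conj, fourier_eq, fourier_eq]
      congr 1 with y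
      rw [smul_smul, ← AddChar.map_add_eq_mul, inner_add_right]
      congr 2; ring
    have h3 : 𝓕 (fun y ↦ ((((C ^ 2 + 1)⁻¹ * ‖θ y‖ ^ 2 : ℝ)) : ℂ)) ξ =
        ((C ^ 2 + 1 : ℝ) : ℂ)⁻¹ *
          ∫ y, 𝓕 (fun η ↦ Φ (-η)) y * (𝐞 (-⟪y, ξ⟫) • conj (θ y)) := by
      rw [fourier_eq, ← integral_const_mul]
      congr 1 with y
      rw [← h1, mul_smul_comm, Complex.mul_conj, Complex.normSq_eq_norm_sq, mul_smul_comm]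
      push_cast; rfl
    rw [h3, integral_fourier_mul_eq_integral_mul_fourier hΦneg hθξ]
    simp_rw [h2]
    rw [integral_eq_zero_of_ae, mul_zero]
    refine .of_forall fun η ↦ ?_
    simp only [Pi.zero_apply, hΦ]
    rcases le_or_gt (1 / 2) ‖η‖ with h | h
    · simp [hφ (-η) (by simpa using h)]
    · rw [hφ (-(η + ξ))]; · simp
      rw [norm_neg]
      have : ‖ξ‖ ≤ ‖η + ξ‖ + ‖η‖ := by simpa using norm_sub_le (η + ξ) η
      linarith

lemma exists_integral_norm_translate_sub_le (ψ : 𝓢(V, ℂ)) :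
    ∃ C : ℝ, ∀ y, ‖y‖ ≤ 1 → ∫ x, ‖ψ (x + y) - ψ x‖ ≤ C * ‖y‖ := by
  set N := finrank ℝ V + 1 with hN
  obtain ⟨C, hC⟩ : ∃ C : ℝ, ∀ z, (1 + ‖z‖) ^ N * ‖fderiv ℝ ψ z‖ ≤ C := by
    have h := SchwartzMap.one_add_le_sup_seminorm_apply (𝕜 := ℂ) (m := (N, 1))
      le_rfl le_rfl ψ
    simp only [norm_iteratedFDeriv_one] at h
    exact ⟨_, h⟩
  have hC0 : 0 ≤ C := (by positivity : (0 : ℝ) ≤ _).trans (hC 0)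
  have hint : Integrable (fun x : V ↦ (1 + ‖x‖) ^ (-(N : ℝ))) :=
    integrable_one_add_norm (by rw [hN]; push_cast; linarith)
  refine ⟨2 ^ N * C * ∫ x : V, (1 + ‖x‖) ^ (-(N : ℝ)), fun y hy ↦ ?_⟩
  have hpt : ∀ x, ‖ψ (x + y) - ψ x‖ ≤ 2 ^ N * C * ‖y‖ * (1 + ‖x‖) ^ (-(N : ℝ)) := by
    intro x
    have hderiv : ∀ z ∈ Metric.closedBall x 1,
        ‖fderiv ℝ ψ z‖ ≤ 2 ^ N * C * (1 + ‖x‖) ^ (-(N : ℝ)) := by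
      intro z hz
      have h1 : 1 + ‖x‖ ≤ 2 * (1 + ‖z‖) := by
        have h2 : ‖z - x‖ ≤ 1 := by simpa [dist_eq_norm] using hz
        have h3 : ‖x‖ ≤ ‖z‖ + ‖z - x‖ := by simpa using norm_sub_le z (z - x)
        linarith [norm_nonneg z]
      rw [rpow_neg (by positivity), rpow_natCast, ← div_eq_mul_inv, le_div_iff₀ (by positivity)]
      calc ‖fderiv ℝ ψ z‖ * (1 + ‖x‖) ^ N ≤ ‖fderiv ℝ ψ z‖ * (2 * (1 + ‖z‖)) ^ N := by gcongr
        _ = 2 ^ N * ((1 + ‖z‖) ^ N * ‖fderiv ℝ ψ z‖) := by rw [mul_pow]; ring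
        _ ≤ _ := by gcongr; exact hC z
    have h := (convex_closedBall x 1).norm_image_sub_le_of_norm_fderiv_le (𝕜 := ℝ)
      (fun z _ ↦ ψ.differentiableAt) hderiv (Metric.mem_closedBall_self zero_le_one)
      (show x + y ∈ Metric.closedBall x 1 by simpa using hy)
    rw [add_sub_cancel_left] at h
    linarith
  calc ∫ x, ‖ψ (x + y) - ψ x‖ ≤ ∫ x, 2 ^ N * C * ‖y‖ * (1 + ‖x‖) ^ (-(N : ℝ)) :=
        integral_mono ((ψ.integrable.comp_add_right y).sub ψ.integrable).norm
          (hint.const_mul _) hpt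
    _ = _ := by rw [integral_const_mul]; ring

lemma integral_norm_integral_mul_sub_le {k G : V → ℂ} (hk : Integrable k) (hG : Integrable G) :
    ∫ x, ‖∫ z, k z * G (x - z)‖ ≤ (∫ z, ‖k z‖) * ∫ x, ‖G x‖ := by
  have h := integral_convolution (μ := (volume : Measure V)) (ν := volume)
    (ContinuousLinearMap.mul ℝ ℝ) hk.norm hG.norm
  simp only [convolution_def, ContinuousLinearMap.mul_apply'] at h
  rw [← h]
  refine integral_mono ?_ ?_ fun x ↦ ?_
  · exact (hk.integrable_convolution (ContinuousLinearMap.mul ℂ ℂ) hG).norm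
  · exact hk.norm.integrable_convolution (ContinuousLinearMap.mul ℝ ℝ) hG.norm
  · refine (norm_integral_le_integral_norm _).trans (le_of_eq ?_)
    simp

lemma exists_integral_norm_second_difference_le {F : V → ℂ} (hF : Integrable F)
    (hFb : ∃ B, ∀ x, ‖F x‖ ≤ B) {ψ : 𝓢(V, ℂ)} (hψ : ∀ x, F x = ∫ z, ψ z * F (x - z)) :
    ∃ C : ℝ, ∀ y,
      ∫ x, ‖F x - (F (x + y) + F (x - y)) / 2‖ ≤ C * min 1 (‖y‖ ^ 2) := by
  obtain ⟨C, hC⟩ := exists_integral_norm_translate_sub_le ψ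
  have hdiff : ∀ (G : V → ℂ) (y : V), Integrable G → (∃ B, ∀ x, ‖G x‖ ≤ B) →
      (∀ x, G x = ∫ z, ψ z * G (x - z)) →
      ∀ x, G (x + y) - G x = ∫ z, (ψ (z + y) - ψ z) * G (x - z) := by
    rintro G y hG ⟨B, hB⟩ hG' x
    have hi : ∀ x, Integrable (fun z ↦ ψ z * G (x - z)) := fun x ↦
      ψ.integrable.mul_bdd (c := B) (hG.comp_sub_left x).aestronglyMeasurable
        (.of_forall fun z ↦ hB _)
    have h1 : ∫ z, ψ z * G (x + y - z) = ∫ z, ψ (z + y) * G (x - z) := by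
      rw [← integral_add_right_eq_self _ y]
      congr 1 with z
      congr 2; abel
    have h2 : Integrable (fun z ↦ ψ (z + y) * G (x - z)) := by
      refine ((hi (x + y)).comp_add_right y).congr (.of_forall fun z ↦ ?_)
      change ψ (z + y) * G (x + y - (z + y)) = _
      congr 2; abel
    rw [hG' (x + y), hG' x, h1, ← integral_sub h2 (hi x)]
    congr 1 with z
    ring
  have htr : ∀ y, Integrable (fun z ↦ ψ (z + y) - ψ z) := fun y ↦
    (ψ.integrable.comp_add_right y).sub ψ.integrable
  have hI : 0 ≤ ∫ x, ‖F x‖ := integral_nonneg fun x ↦ norm_nonneg _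
  refine ⟨max (2 * ∫ x, ‖F x‖) (C ^ 2 * ∫ x, ‖F x‖), fun y ↦ ?_⟩
  have hF1 := hF.comp_add_right y
  have hF2 := hF.comp_sub_right y
  have hbig : ∫ x, ‖F x - (F (x + y) + F (x - y)) / 2‖ ≤ 2 * ∫ x, ‖F x‖ := by
    have h : ∀ x, ‖F x - (F (x + y) + F (x - y)) / 2‖ ≤
        ‖F x‖ + (‖F (x + y)‖ + ‖F (x - y)‖) / 2 := by
      intro x
      refine (norm_sub_le _ _).trans ?_
      rw [norm_div, Complex.norm_ofNat]
      gcongr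
      exact norm_add_le _ _
    have hm : Integrable fun x ↦ (‖F (x + y)‖ + ‖F (x - y)‖) / 2 :=
      (hF1.norm.add hF2.norm).div_const 2
    refine (integral_mono (hF.sub ((hF1.add hF2).div_const 2)).norm
      (hF.norm.add hm) h).trans (le_of_eq ?_)
    simp only [Pi.add_apply]
    rw [integral_add hF.norm hm, integral_div,
      integral_add hF1.norm hF2.norm, integral_add_right_eq_self (fun x ↦ ‖F x‖),
      integral_sub_right_eq_self (fun x ↦ ‖F x‖)]
    ring
  rcases le_or_gt ‖y‖ 1 with hy | hy
  · rw [min_eq_right (pow_le_one₀ (norm_nonneg _) hy)]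
    set G : V → ℂ := fun x ↦ F (x + y) - F x with hGdef
    have hGi : Integrable G := hF1.sub hF
    obtain ⟨B, hB⟩ := hFb
    have hFi : ∀ x, Integrable (fun z ↦ ψ z * F (x - z)) := fun x ↦
      ψ.integrable.mul_bdd (c := B) (hF.comp_sub_left x).aestronglyMeasurable
        (.of_forall fun z ↦ hB _)
    have hGb : ∃ B, ∀ x, ‖G x‖ ≤ B :=
      ⟨B + B, fun x ↦ (norm_sub_le _ _).trans (add_le_add (hB _) (hB _))⟩
    have hGψ : ∀ x, G x = ∫ z, ψ z * G (x - z) := by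
      intro x
      simp only [hGdef]
      rw [hψ (x + y), hψ x, ← integral_sub (hFi _) (hFi _)]
      congr 1 with z
      rw [mul_sub]; congr 3; abel
    have h1 : ∫ x, ‖G x‖ ≤ (C * ‖y‖) * ∫ x, ‖F x‖ := by
      have := integral_norm_integral_mul_sub_le (htr y) hF
      simp_rw [← hdiff F y hF ⟨B, hB⟩ hψ] at this
      exact this.trans (mul_le_mul_of_nonneg_right (hC y hy) hI)
    have h2 : ∫ x, ‖G (x + y) - G x‖ ≤ (C * ‖y‖) * ∫ x, ‖G x‖ := by
      have := integral_norm_integral_mul_sub_le (htr y) hGi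
      simp_rw [← hdiff G y hGi hGb hGψ] at this
      exact this.trans (mul_le_mul_of_nonneg_right (hC y hy) (integral_nonneg fun x ↦ norm_nonneg _))
    have h3 : ∫ x, ‖F x - (F (x + y) + F (x - y)) / 2‖ = (∫ x, ‖G (x + y) - G x‖) / 2 := by
      rw [← integral_add_right_eq_self (fun x ↦ ‖F x - (F (x + y) + F (x - y)) / 2‖) y,
        ← integral_div]
      congr 1 with x
      have : F (x + y) - (F (x + y + y) + F (x + y - y)) / 2 = -((G (x + y) - G x) / 2) := by
        simp only [hGdef, add_sub_cancel_right]; ring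
      rw [this, norm_neg, norm_div, Complex.norm_ofNat]
    have h0 : 0 ≤ C * ‖y‖ := (integral_nonneg fun x ↦ norm_nonneg _).trans (hC y hy)
    have h4 : 0 ≤ ∫ x, ‖G (x + y) - G x‖ := integral_nonneg fun x ↦ norm_nonneg _
    rw [h3]
    calc (∫ x, ‖G (x + y) - G x‖) / 2 ≤ ∫ x, ‖G (x + y) - G x‖ := by linarith
      _ ≤ (C * ‖y‖) * ((C * ‖y‖) * ∫ x, ‖F x‖) := h2.trans (by gcongr)
      _ = (C ^ 2 * ∫ x, ‖F x‖) * ‖y‖ ^ 2 := by ring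
      _ ≤ _ := by gcongr; exact le_max_right _ _
  · rw [min_eq_left (one_le_pow₀ hy.le), mul_one]
    exact hbig.trans (le_max_left _ _)

lemma exists_forall_bandLimited_le_levyKernel {γ : ℝ} (hγ0 : 0 < γ) (hγ2 : γ < 2) :
    ∃ c : ℝ, 0 < c ∧ ∀ r : ℝ, 0 < r → ∃ k : V → ℝ, (∀ y, 0 ≤ k y) ∧ Integrable k ∧
      ∫ y, k y = c * r ^ γ ∧ (∀ y, y ≠ 0 → k y ≤ levyKernel γ y) ∧
      ∀ ξ, r ≤ ‖ξ‖ → 𝓕 (fun y ↦ (k y : ℂ)) ξ = 0 := by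
  obtain ⟨k, hk0, hki, hkpos, hkle, hkF⟩ := exists_bandLimited_le_levyKernel (V := V) hγ0 hγ2
  refine ⟨_, hkpos, fun r hr ↦ ⟨fun y ↦ r ^ (finrank ℝ V + γ) * k (r • y), fun y ↦ ?_, ?_, ?_,
    fun y hy ↦ ?_, fun ξ hξ ↦ ?_⟩⟩
  · exact mul_nonneg (by positivity) (hk0 _)
  · exact (hki.comp_smul hr.ne').const_mul _
  · rw [integral_const_mul, Measure.integral_comp_smul, abs_of_nonneg (by positivity),
      smul_eq_mul, rpow_add hr, rpow_natCast]
    field_simp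
  · have h := hkle (r • y) (smul_ne_zero hr.ne' hy)
    rw [levyKernel_smul γ hr] at h
    calc r ^ (finrank ℝ V + γ) * k (r • y)
        ≤ r ^ (finrank ℝ V + γ) * (r ^ (-(finrank ℝ V + γ)) * levyKernel γ y) := by gcongr
      _ = levyKernel γ y := by rw [← mul_assoc, ← rpow_add hr]; simp
  · have h1 := Measure.integral_comp_smul (volume : Measure V)
      (fun y ↦ 𝐞 (-⟪y, r⁻¹ • ξ⟫) • (k y : ℂ)) r
    have h2 : ∫ y, 𝐞 (-⟪y, r⁻¹ • ξ⟫) • (k y : ℂ) = 0 :=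
      hkF (r⁻¹ • ξ) (by
        rw [norm_smul, norm_inv, norm_of_nonneg hr.le, inv_mul_eq_div, le_div_iff₀ hr]; simpa)
    rw [h2, smul_zero] at h1
    have h3 : ∀ y, ⟪r • y, r⁻¹ • ξ⟫ = ⟪y, ξ⟫ := by
      intro y
      rw [real_inner_smul_left, real_inner_smul_right, mul_inv_cancel_left₀ hr.ne']
    simp_rw [h3] at h1
    rw [fourier_eq]
    simp_rw [Complex.ofReal_mul, ← mul_smul_comm]
    rw [integral_const_mul, h1, mul_zero]

lemma second_difference_fourierInv {u : V → ℂ} (hu : Integrable u) (x y : V) :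
    𝓕⁻ u x - (𝓕⁻ u (x + y) + 𝓕⁻ u (x - y)) / 2 =
      ∫ η, 𝐞 ⟪η, x⟫ • (((1 - cos (2 * π * ⟪y, η⟫) : ℝ) : ℂ) * u η) := by
  have hi : ∀ z, Integrable (fun η ↦ 𝐞 ⟪η, z⟫ • u η) := fun z ↦ by
    simpa using (Real.fourierIntegral_convergent_iff (μ := volume) (f := u) (-z)).2 hu
  have hm : Integrable (fun η ↦ (𝐞 ⟪η, x + y⟫ • u η + 𝐞 ⟪η, x - y⟫ • u η) / 2) :=
    ((hi _).add (hi _)).div_const 2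
  rw [fourierInv_eq, fourierInv_eq, fourierInv_eq, ← integral_add (hi _) (hi _), ← integral_div,
    ← integral_sub (hi _) hm]
  congr 1 with η
  rw [inner_add_right, inner_sub_right, real_inner_comm η y, sub_eq_add_neg ⟪η, x⟫,
    AddChar.map_add_eq_mul, AddChar.map_add_eq_mul]
  simp only [Circle.smul_def, Circle.coe_mul, smul_eq_mul, Real.fourierChar_apply]
  rw [Complex.ofReal_sub, Complex.ofReal_cos, Complex.cos, Complex.ofReal_one]
  have h : (((2 * π * -⟪η, y⟫ : ℝ)) : ℂ) * Complex.I = -((2 * π * ⟪η, y⟫ : ℝ) : ℂ) * Complex.I := by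
    push_cast; ring
  rw [h]
  ring

/-- The singular integral representation of the fractional Laplacian. -/
lemma integral_second_difference_mul_levyKernel [Nontrivial V] {γ C : ℝ} (hγ0 : 0 < γ)
    (hγ2 : γ < 2)
    (hC : ∀ ξ : V, ∫ y : V, (1 - cos (2 * π * ⟪y, ξ⟫)) * levyKernel γ y = C * ‖ξ‖ ^ γ)
    {u : V → ℂ} (hu : Integrable u) {ρ : ℝ} (hρ : ∀ η, u η ≠ 0 → ‖η‖ ≤ ρ) (x : V) :
    Integrable (fun y ↦
      (𝓕⁻ u x - (𝓕⁻ u (x + y) + 𝓕⁻ u (x - y)) / 2) * (levyKernel γ y : ℂ)) ∧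
    ∫ y, (𝓕⁻ u x - (𝓕⁻ u (x + y) + 𝓕⁻ u (x - y)) / 2) * (levyKernel γ y : ℂ) =
      C * 𝓕⁻ (fun η ↦ ((‖η‖ ^ γ : ℝ) : ℂ) * u η) x := by
  set B : ℝ := 2 + (2 * π * ρ) ^ 2
  have hint : Integrable (Function.uncurry fun (y η : V) ↦
      𝐞 ⟪η, x⟫ • (((1 - cos (2 * π * ⟪y, η⟫) : ℝ) : ℂ) * u η) * (levyKernel γ y : ℂ))
      (volume.prod volume) := by
    refine (((integrable_min_mul_levyKernel (V := V) hγ0 hγ2).const_mul B).mul_prod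
      hu.norm).mono' ?_ (.of_forall fun ⟨y, η⟩ ↦ ?_)
    · have h1 : Continuous fun p : V × V ↦ 𝐞 ⟪p.2, x⟫ :=
        Real.continuous_fourierChar.comp (by fun_prop)
      have h2 : Continuous fun p : V × V ↦ ((1 - cos (2 * π * ⟪p.1, p.2⟫) : ℝ) : ℂ) := by fun_prop
      have h3 : Measurable fun p : V × V ↦ (levyKernel γ p.1 : ℂ) :=
        Complex.measurable_ofReal.comp ((measurable_levyKernel γ).comp measurable_fst)
      exact (h1.aestronglyMeasurable.smul (h2.aestronglyMeasurable.mul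
        hu.aestronglyMeasurable.comp_snd)).mul h3.aestronglyMeasurable
    · simp only [Function.uncurry_apply_pair, norm_mul, Circle.norm_smul, Complex.norm_real]
      rw [norm_of_nonneg (levyKernel_nonneg γ y), norm_of_nonneg (by
        linarith [cos_le_one (2 * π * ⟪y, η⟫)])]
      rcases eq_or_ne (u η) 0 with h | h
      · simp [h]
      · have h1 := one_sub_cos_le_min η y (hρ η h)
        have h2 := mul_le_mul_of_nonneg_right h1
          (mul_nonneg (levyKernel_nonneg γ y) (norm_nonneg (u η)))
        linarith
  simp_rw [second_difference_fourierInv hu, ← integral_mul_const]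
  refine ⟨hint.integral_prod_left, ?_⟩
  rw [integral_integral_swap hint, fourierInv_eq, ← integral_const_mul]
  congr 1 with η
  have h : ∀ y, 𝐞 ⟪η, x⟫ • (((1 - cos (2 * π * ⟪y, η⟫) : ℝ) : ℂ) * u η) * (levyKernel γ y : ℂ) =
      (𝐞 ⟪η, x⟫ • u η) * (((1 - cos (2 * π * ⟪y, η⟫)) * levyKernel γ y : ℝ) : ℂ) := by
    intro y
    simp only [Circle.smul_def, smul_eq_mul]
    push_cast; ring
  simp_rw [h]
  rw [integral_const_mul, integral_complex_ofReal, hC]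
  simp only [Circle.smul_def, smul_eq_mul]
  push_cast; ring

lemma integrable_second_difference_mul_sign {F : V → ℂ} (hF : Integrable F) (hFc : Continuous F)
    {C : ℝ} (hC : ∀ y, ∫ x, ‖F x - (F (x + y) + F (x - y)) / 2‖ ≤ C * min 1 (‖y‖ ^ 2))
    {s : V → ℝ} (hs : Measurable s) (hs1 : ∀ x, |s x| ≤ 1) {w : V → ℝ} (hw0 : ∀ y, 0 ≤ w y)
    (hw : AEStronglyMeasurable w) (hwi : Integrable (fun y ↦ min 1 (‖y‖ ^ 2) * w y)) :
    Integrable (Function.uncurry fun y x : V ↦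
      (F x - (F (x + y) + F (x - y)) / 2).re * s x * w y) (volume.prod volume) := by
  have hmeas : AEStronglyMeasurable (Function.uncurry fun y x : V ↦
      (F x - (F (x + y) + F (x - y)) / 2).re * s x * w y) (volume.prod volume) := by
    have h1 : Continuous fun p : V × V ↦
      (F p.2 - (F (p.2 + p.1) + F (p.2 - p.1)) / 2).re := by fun_prop
    exact (h1.aestronglyMeasurable.mul (hs.comp measurable_snd).aestronglyMeasurable).mul hw.comp_fst
  have hD : ∀ y, Integrable (fun x ↦ F x - (F (x + y) + F (x - y)) / 2) := fun y ↦
    hF.sub (((hF.comp_add_right y).add (hF.comp_sub_right y)).div_const 2)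
  have hDs : ∀ y, Integrable (fun x ↦ (F x - (F (x + y) + F (x - y)) / 2).re * s x) := fun y ↦
    (hD y).re.mul_bdd (c := 1) hs.aestronglyMeasurable (.of_forall hs1)
  rw [integrable_prod_iff hmeas]
  refine ⟨.of_forall fun y ↦ (hDs y).mul_const (w y), ?_⟩
  refine (hwi.const_mul C).mono' hmeas.norm.integral_prod_right' (.of_forall fun y ↦ ?_)
  rw [norm_of_nonneg (integral_nonneg fun x ↦ norm_nonneg _)]
  simp only [Function.uncurry_apply_pair, norm_mul]
  rw [integral_mul_const, norm_of_nonneg (hw0 y), ← mul_assoc]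
  refine mul_le_mul_of_nonneg_right (le_trans ?_ (hC y)) (hw0 y)
  refine integral_mono ?_ (hD y).norm fun x ↦ ?_
  · simpa only [norm_mul] using (hDs y).norm
  · exact (mul_le_of_le_one_right (norm_nonneg _) (hs1 x)).trans (Complex.abs_re_le_norm _)

lemma mul_integral_abs_re_le_integral_second_difference {F : V → ℂ} (hF : Integrable F)
    (hFc : Continuous F) {C : ℝ}
    (hC : ∀ y, ∫ x, ‖F x - (F (x + y) + F (x - y)) / 2‖ ≤ C * min 1 (‖y‖ ^ 2))
    {s : V → ℝ} (hs : Measurable s) (hs1 : ∀ x, |s x| ≤ 1) (hsF : ∀ x, (F x).re * s x = |(F x).re|)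
    {w : V → ℝ} (hw0 : ∀ y, 0 ≤ w y) (hw : Measurable w)
    (hwi : Integrable (fun y ↦ min 1 (‖y‖ ^ 2) * w y))
    {k : V → ℝ} (hk0 : ∀ y, 0 ≤ k y) (hk : Integrable k) (hkw : ∀ y, y ≠ 0 → k y ≤ w y)
    (hkF : ∀ x, ∫ y, (F x - (F (x + y) + F (x - y)) / 2).re * k y = (∫ y, k y) * (F x).re) :
    (∫ y, k y) * ∫ x, |(F x).re| ≤
      ∫ x, (∫ y, (F x - (F (x + y) + F (x - y)) / 2).re * w y) * s x := by
  have hki : Integrable (fun y ↦ min 1 (‖y‖ ^ 2) * k y) := by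
    refine hk.bdd_mul (c := 1) (by fun_prop) (.of_forall fun y ↦ ?_)
    rw [norm_of_nonneg (by positivity)]
    exact min_le_left _ _
  have hiw := integrable_second_difference_mul_sign hF hFc hC hs hs1 hw0
    hw.aestronglyMeasurable hwi
  have hik := integrable_second_difference_mul_sign hF hFc hC hs hs1 hk0
    hk.aestronglyMeasurable hki
  set A : V → ℝ := fun y ↦ ∫ x, (F x - (F (x + y) + F (x - y)) / 2).re * s x with hA
  have hA0 : A 0 = 0 := by
    simp only [hA, add_zero, sub_zero, add_self_div_two, sub_self, Complex.zero_re, zero_mul,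
      integral_zero]
  have hre : Integrable fun x ↦ (F x).re := hF.re
  have hAnonneg : ∀ y, 0 ≤ A y := by
    intro y
    have h1 := (hre.abs.comp_add_right y)
    have h2 := (hre.abs.comp_sub_right y)
    have hm : Integrable fun x ↦ (|(F (x + y)).re| + |(F (x - y)).re|) / 2 :=
      (h1.add h2).div_const 2
    have h3 : ∫ x, (|(F x).re| - (|(F (x + y)).re| + |(F (x - y)).re|) / 2) = 0 := by
      rw [integral_sub hre.abs hm, integral_div, integral_add h1 h2,
        integral_add_right_eq_self (fun x ↦ |(F x).re|),
        integral_sub_right_eq_self (fun x ↦ |(F x).re|)]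
      ring
    rw [← h3]
    refine integral_mono (hre.abs.sub hm) ?_ fun x ↦ ?_
    · exact (hF.sub (((hF.comp_add_right y).add (hF.comp_sub_right y)).div_const 2)).re.mul_bdd
        (c := 1) hs.aestronglyMeasurable (.of_forall hs1)
    · have hle : ∀ a : ℝ, a * s x ≤ |a| := fun a ↦ by
        refine (le_abs_self _).trans ?_
        rw [abs_mul]
        exact mul_le_of_le_one_right (abs_nonneg _) (hs1 x)
      have h4 : (F x - (F (x + y) + F (x - y)) / 2).re =
          (F x).re - ((F (x + y)).re + (F (x - y)).re) / 2 := by simp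
      simp only [h4, sub_mul, hsF x]
      linarith [hle (F (x + y)).re, hle (F (x - y)).re]
  have hswap : ∀ v : V → ℝ, Integrable (Function.uncurry fun y x : V ↦
      (F x - (F (x + y) + F (x - y)) / 2).re * s x * v y) (volume.prod volume) →
      ∫ y, A y * v y = ∫ x, (∫ y, (F x - (F (x + y) + F (x - y)) / 2).re * v y) * s x := by
    intro v hv
    simp only [hA, ← integral_mul_const]
    rw [integral_integral_swap hv]
    simp only [mul_right_comm]
  have hAi : ∀ v : V → ℝ, Integrable (Function.uncurry fun y x : V ↦
      (F x - (F (x + y) + F (x - y)) / 2).re * s x * v y) (volume.prod volume) →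
      Integrable fun y ↦ A y * v y := by
    intro v hv
    refine hv.integral_prod_left.congr (.of_forall fun y ↦ ?_)
    simp only [Function.uncurry_apply_pair, integral_mul_const, hA]
  calc (∫ y, k y) * ∫ x, |(F x).re|
      = ∫ x, (∫ y, (F x - (F (x + y) + F (x - y)) / 2).re * k y) * s x := by
        simp_rw [hkF, mul_assoc, hsF]
        rw [integral_const_mul]
    _ = ∫ y, A y * k y := (hswap k hik).symm
    _ ≤ ∫ y, A y * w y := by
        refine integral_mono (hAi k hik) (hAi w hiw) fun y ↦ ?_
        rcases eq_or_ne y 0 with rfl | hy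
        · simp [hA0]
        · exact mul_le_mul_of_nonneg_left (hkw y hy) (hAnonneg y)
    _ = _ := hswap w hiw

lemma measurable_real_sign : Measurable Real.sign := by
  unfold Real.sign
  exact Measurable.ite measurableSet_Iio measurable_const
    (Measurable.ite measurableSet_Ioi measurable_const measurable_const)

lemma mul_real_sign (a : ℝ) : a * Real.sign a = |a| := by
  rcases lt_trichotomy a 0 with h | rfl | h
  · rw [Real.sign_of_neg h, abs_of_neg h]; ring
  · simp
  · rw [Real.sign_of_pos h, abs_of_pos h]; ring

lemma abs_real_sign_le_one (a : ℝ) : |Real.sign a| ≤ 1 := by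
  rcases Real.sign_apply_eq a with h | h | h <;> simp [h]

lemma integral_second_difference_mul_bandLimited {u : V → ℂ} (hu : Integrable u) {r : ℝ}
    (hur : ∀ η, u η ≠ 0 → r ≤ ‖η‖) {k : V → ℝ} (hk : Integrable k)
    (hkF : ∀ ξ, r ≤ ‖ξ‖ → 𝓕 (fun y ↦ (k y : ℂ)) ξ = 0) (x : V) :
    ∫ y, (𝓕⁻ u x - (𝓕⁻ u (x + y) + 𝓕⁻ u (x - y)) / 2).re * k y = (∫ y, k y) * (𝓕⁻ u x).re := by
  obtain ⟨B, hB⟩ : ∃ B : ℝ, ∀ z, ‖𝓕⁻ u z‖ ≤ B :=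
    ⟨_, fun z ↦ VectorFourier.norm_fourierIntegral_le_integral_norm _ _ _ _ z⟩
  have hc := continuous_fourierInv hu
  have hk' : Integrable (fun y ↦ (k y : ℂ)) := hk.ofReal
  have hi1 : Integrable (fun y ↦ (k y : ℂ) * 𝓕⁻ u (x + y)) :=
    hk'.mul_bdd (c := B) (by fun_prop) (.of_forall fun y ↦ hB _)
  have hi2 : Integrable (fun y ↦ (k y : ℂ) * 𝓕⁻ u (x - y)) :=
    hk'.mul_bdd (c := B) (by fun_prop) (.of_forall fun y ↦ hB _)
  have hzero : ∀ v : V → ℂ, (∀ η, r ≤ ‖η‖ → v η = 0) → 𝓕⁻ (fun η ↦ u η * v η) x = 0 := by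
    intro v hv
    have : (fun η ↦ u η * v η) = 0 := by
      ext η
      rcases eq_or_ne (u η) 0 with h | h
      · simp [h]
      · simp [hv η (hur η h)]
    rw [this, fourierInv_eq]; simp
  have h2 : ∫ y, (k y : ℂ) * 𝓕⁻ u (x - y) = 0 := by
    rw [integral_mul_fourierInv_sub hu hk']
    exact hzero _ hkF
  have h1 : ∫ y, (k y : ℂ) * 𝓕⁻ u (x + y) = 0 := by
    rw [← integral_neg_eq_self]
    simp_rw [← sub_eq_add_neg]
    rw [integral_mul_fourierInv_sub hu hk'.comp_neg]
    refine hzero _ fun η hη ↦ ?_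
    rw [← fourierInv_eq_fourier_comp_neg (fun y ↦ (k y : ℂ)), fourierInv_eq_fourier_neg]
    exact hkF _ (by simpa using hη)
  have h3 : ∫ y, (k y : ℂ) * (𝓕⁻ u x - (𝓕⁻ u (x + y) + 𝓕⁻ u (x - y)) / 2) =
      ((∫ y, k y : ℝ) : ℂ) * 𝓕⁻ u x := by
    have hm : Integrable fun y ↦
        ((k y : ℂ) * 𝓕⁻ u (x + y) + (k y : ℂ) * 𝓕⁻ u (x - y)) / 2 := (hi1.add hi2).div_const 2
    simp_rw [mul_sub, mul_div_assoc', mul_add]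
    rw [integral_sub (hk'.mul_const _) hm, integral_div, integral_add hi1 hi2, h1, h2,
      integral_mul_const, integral_complex_ofReal]
    simp
  have hi3 : Integrable (fun y ↦ (k y : ℂ) *
      (𝓕⁻ u x - (𝓕⁻ u (x + y) + 𝓕⁻ u (x - y)) / 2)) := by
    refine ((hk'.mul_const (𝓕⁻ u x)).sub ((hi1.add hi2).div_const 2)).congr
      (.of_forall fun y ↦ ?_)
    simp only [Pi.sub_apply, Pi.add_apply]
    ring
  rw [← Complex.re_ofReal_mul, ← h3, ← Complex.reCLM_apply,
    ← Complex.reCLM.integral_comp_comm hi3]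
  congr 1 with y
  rw [Complex.reCLM_apply, Complex.re_ofReal_mul, mul_comm]

/-- The lower bound for `∫ (|∇|^γ f) sgn f` in the unitary normalization of `𝓕`: only the
lower bound on the frequencies matters for the constant. -/
theorem exists_mul_integral_abs_le_integral_fourierInv_mul_sign [Nontrivial V] {γ : ℝ}
    (hγ0 : 0 < γ) (hγ2 : γ < 2) :
    ∃ c : ℝ, 0 < c ∧ ∀ (r ρ : ℝ) (f : V → ℝ), 0 < r → Integrable f →
      (∀ η, 𝓕 (fun x ↦ (f x : ℂ)) η ≠ 0 → r ≤ ‖η‖ ∧ ‖η‖ ≤ ρ) →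
      c * r ^ γ * ∫ x, |f x| ≤
        ∫ x, (𝓕⁻ (fun η ↦ ((‖η‖ ^ γ : ℝ) : ℂ) * 𝓕 (fun x ↦ (f x : ℂ)) η) x).re *
          Real.sign (f x) := by
  obtain ⟨C, hC0, hC⟩ := exists_integral_one_sub_cos_mul_levyKernel (V := V) hγ0 hγ2
  obtain ⟨c, hc0, hc⟩ := exists_forall_bandLimited_le_levyKernel (V := V) hγ0 hγ2
  refine ⟨c / C, by positivity, fun r ρ f hr hf hsupp ↦ ?_⟩
  obtain ⟨k, hk0, hki, hkc, hkle, hkF⟩ := hc r hr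
  have hf' : Integrable (fun x ↦ (f x : ℂ)) := hf.ofReal
  set u : V → ℂ := 𝓕 (fun x ↦ (f x : ℂ)) with hu_def
  have huc : Continuous u := continuous_fourier hf'
  have hu : Integrable u := by
    refine huc.integrable_of_hasCompactSupport
      (HasCompactSupport.intro (isCompact_closedBall 0 ρ) fun η hη ↦ ?_)
    by_contra h
    exact hη (by simpa using (hsupp η h).2)
  have hFf : 𝓕⁻ u =ᵐ[volume] fun x ↦ (f x : ℂ) := fourierInv_fourier_ae_eq hf' hu
  have hF : Integrable (𝓕⁻ u) := hf'.congr hFf.symm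
  have hFc : Continuous (𝓕⁻ u) := continuous_fourierInv hu
  obtain ⟨ψ, hψ⟩ := exists_schwartzMap_fourier_eq_one (V := V) ρ
  have hFψ : ∀ x, 𝓕⁻ u x = ∫ z, ψ z * 𝓕⁻ u (x - z) := by
    intro x
    rw [integral_mul_fourierInv_sub hu ψ.integrable]
    have h : (fun η ↦ u η * 𝓕 (ψ : V → ℂ) η) = u := by
      ext η
      rcases eq_or_ne (u η) 0 with h | h
      · simp [h]
      · rw [hψ η (hsupp η h).2, mul_one]
    rw [h]
  obtain ⟨D, hD⟩ := exists_integral_norm_second_difference_le hF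
    ⟨_, fun z ↦ VectorFourier.norm_fourierIntegral_le_integral_norm _ _ _ _ z⟩ hFψ
  have key := mul_integral_abs_re_le_integral_second_difference hF hFc hD
    (s := fun x ↦ Real.sign (𝓕⁻ u x).re)
    (measurable_real_sign.comp (Complex.measurable_re.comp hFc.measurable))
    (fun x ↦ abs_real_sign_le_one _) (fun x ↦ mul_real_sign _)
    (levyKernel_nonneg γ) (measurable_levyKernel γ) (integrable_min_mul_levyKernel hγ0 hγ2)
    hk0 hki hkle
    (integral_second_difference_mul_bandLimited hu (fun η h ↦ (hsupp η h).1) hki hkF)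
  have hrep : ∀ x, ∫ y, (𝓕⁻ u x - (𝓕⁻ u (x + y) + 𝓕⁻ u (x - y)) / 2).re * levyKernel γ y =
      C * (𝓕⁻ (fun η ↦ ((‖η‖ ^ γ : ℝ) : ℂ) * u η) x).re := by
    intro x
    obtain ⟨hi, heq⟩ := integral_second_difference_mul_levyKernel hγ0 hγ2 hC hu
      (fun η h ↦ (hsupp η h).2) x
    rw [← Complex.re_ofReal_mul, ← heq, ← Complex.reCLM_apply,
      ← Complex.reCLM.integral_comp_comm hi]
    congr 1 with y
    rw [Complex.reCLM_apply, Complex.re_mul_ofReal]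
  simp_rw [hrep, mul_assoc] at key
  rw [integral_const_mul, hkc] at key
  have h1 : ∫ x, |(𝓕⁻ u x).re| = ∫ x, |f x| := by
    refine integral_congr_ae ?_
    filter_upwards [hFf] with x hx
    rw [hx, Complex.ofReal_re]
  have h2 : ∫ x, (𝓕⁻ (fun η ↦ ((‖η‖ ^ γ : ℝ) : ℂ) * u η) x).re * Real.sign (𝓕⁻ u x).re =
      ∫ x, (𝓕⁻ (fun η ↦ ((‖η‖ ^ γ : ℝ) : ℂ) * u η) x).re * Real.sign (f x) := by
    refine integral_congr_ae ?_
    filter_upwards [hFf] with x hx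
    rw [hx, Complex.ofReal_re]
  rw [h1, h2] at key
  rw [div_mul_eq_mul_div, div_mul_eq_mul_div, div_le_iff₀ hC0]
  linarith

end Fourier

/-- Lower bound `∫ (|∇|^γ f) sgn(f) ≥ c₂ 2^{jγ} ‖f‖_{L¹}` for real-valued `f ∈ L¹`
frequency-localized to the dyadic annulus `{2^{j-1} ≤ |ξ| ≤ (7/6) 2^j}`, with `c₂`
depending only on `(γ, n)`.  Here `Ff` is the Fourier transform of `f` and
`Λf = 𝓕⁻¹(|ξ|^γ Ff)` represents `|∇|^γ f`. -/
theorem fractional_laplacian_L1_lower_bound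
    (n : ℕ) (hn : 1 ≤ n) (γ : ℝ) (hγ0 : 0 < γ) (hγ2 : γ < 2) :
    ∃ c₂ : ℝ, 0 < c₂ ∧
      ∀ (j : ℤ) (f : EuclideanSpace ℝ (Fin n) → ℝ)
        (Ff Λf : EuclideanSpace ℝ (Fin n) → ℂ),
        Integrable f volume →
        (∀ ξ, Ff ξ = ∫ x, Complex.exp (-Complex.I * (⟪x, ξ⟫ : ℂ)) * (f x : ℂ)) →
        (∀ ξ, Ff ξ ≠ 0 → (2 : ℝ) ^ ((j : ℝ) - 1) ≤ ‖ξ‖ ∧ ‖ξ‖ ≤ 7 / 6 * (2 : ℝ) ^ (j : ℝ)) →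
        (∀ x, Λf x = (((2 * Real.pi) ^ (-(n : ℝ)) : ℝ) : ℂ) *
          ∫ ξ, ((‖ξ‖ ^ γ : ℝ) : ℂ) * Ff ξ * Complex.exp (Complex.I * (⟪x, ξ⟫ : ℂ))) →
        c₂ * (2 : ℝ) ^ ((j : ℝ) * γ) * (∫ x, |f x|) ≤
          ∫ x, (Λf x).re * Real.sign (f x) := by
  have : Nonempty (Fin n) := ⟨⟨0, hn⟩⟩
  obtain ⟨c, hc0, hc⟩ := exists_mul_integral_abs_le_integral_fourierInv_mul_sign
    (V := EuclideanSpace ℝ (Fin n)) hγ0 hγ2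
  refine ⟨c * 2 ^ (-γ), by positivity, fun j f Ff Λf hf hFf hsupp hΛ ↦ ?_⟩
  have hπ : 0 < 2 * π := by positivity
  have hu : ∀ η, 𝓕 (fun x ↦ (f x : ℂ)) η = Ff ((2 * π) • η) := by
    intro η
    rw [fourier_eq', hFf]
    congr 1 with x
    rw [real_inner_smul_right, smul_eq_mul]
    congr 2; push_cast; ring
  have hΛ' : ∀ x, Λf x = (((2 * π) ^ γ : ℝ) : ℂ) *
      𝓕⁻ (fun η ↦ ((‖η‖ ^ γ : ℝ) : ℂ) * 𝓕 (fun x ↦ (f x : ℂ)) η) x := by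
    intro x
    have h1 := Measure.integral_comp_smul (volume : Measure (EuclideanSpace ℝ (Fin n)))
      (fun ξ ↦ ((‖ξ‖ ^ γ : ℝ) : ℂ) * Ff ξ * Complex.exp (Complex.I * (⟪x, ξ⟫ : ℂ))) (2 * π)
    rw [finrank_euclideanSpace_fin, abs_of_nonneg (by positivity), ← rpow_natCast,
      ← rpow_neg hπ.le, Complex.real_smul] at h1
    rw [hΛ, ← h1, fourierInv_eq', ← integral_const_mul]
    congr 1 with η
    rw [norm_smul, norm_of_nonneg hπ.le, mul_rpow hπ.le (norm_nonneg _), ← hu,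
      real_inner_smul_right, real_inner_comm η x, smul_eq_mul]
    have h2 : Complex.I * ((2 * π * ⟪η, x⟫ : ℝ) : ℂ) = ((2 * π * ⟪η, x⟫ : ℝ) : ℂ) * Complex.I :=
      mul_comm _ _
    rw [h2]
    push_cast; ring
  have key := hc ((2 : ℝ) ^ ((j : ℝ) - 1) / (2 * π)) (7 / 6 * (2 : ℝ) ^ (j : ℝ) / (2 * π)) f
    (by positivity) hf (fun η hη ↦ by
      rw [hu] at hη
      have h := hsupp _ hη
      rw [norm_smul, norm_of_nonneg hπ.le] at h
      rw [div_le_iff₀ hπ, le_div_iff₀ hπ, mul_comm ‖η‖]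
      exact h)
  have h3 : (2 * π) ^ γ * ((2 : ℝ) ^ ((j : ℝ) - 1) / (2 * π)) ^ γ =
      2 ^ (-γ) * 2 ^ ((j : ℝ) * γ) := by
    rw [← mul_rpow hπ.le (by positivity), mul_div_cancel₀ _ hπ.ne', ← rpow_mul zero_le_two,
      ← rpow_add zero_lt_two]
    congr 1; ring
  simp_rw [hΛ', Complex.re_ofReal_mul, mul_assoc]
  rw [integral_const_mul]
  calc c * (2 ^ (-γ) * (2 ^ ((j : ℝ) * γ) * ∫ x, |f x|))
      = (2 * π) ^ γ * (c * ((2 : ℝ) ^ ((j : ℝ) - 1) / (2 * π)) ^ γ * ∫ x, |f x|) := by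
        linear_combination (-c * ∫ x, |f x|) * h3
    _ ≤ _ := by gcongr
end

section
/- Let n ≥ 1, 0 < γ < 1, and define σ(ξ, η) = |ξ|^γ + |η|^γ − |ξ+η|^γ for ξ, η ∈ ℝⁿ. For all multi-indices α, β there exists a constant C = C(α, β, γ, n) > 0 such that for all ξ, η ∈ ℝⁿ with 0 < |ξ| ≤ 1/100 and 1/2 ≤ |η| ≤ 2: |∂_ξ^α ∂_η^β σ(ξ, η)| ≤ C · |ξ|^{γ−|α|}. -/
open Filter Topology

/-- The power `x ↦ ‖x‖ ^ γ` of the norm is smooth away from the origin. -/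
theorem contDiffAt_norm_rpow {E : Type*} [NormedAddCommGroup E] [InnerProductSpace ℝ E]
    (γ : ℝ) {m : WithTop ℕ∞} {x : E} (hx : x ≠ 0) :
    ContDiffAt ℝ m (fun y : E => ‖y‖ ^ γ) x :=
  (contDiffAt_norm ℝ hx).rpow_const_of_ne (norm_ne_zero_iff.mpr hx)

/-- Iterated derivatives of a dilated function; no smoothness is needed. -/
theorem iteratedFDeriv_comp_const_smul_apply {E F : Type*} [NormedAddCommGroup E]
    [NormedSpace ℝ E] [NormedAddCommGroup F] [NormedSpace ℝ F] (f : E → F) (a : ℝ) (i : ℕ) :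
    iteratedFDeriv ℝ i (fun z => f (a • z)) = fun x => a ^ i • iteratedFDeriv ℝ i f (a • x) := by
  induction i with
  | zero => ext; simp
  | succ i hi =>
    ext x v
    rw [iteratedFDeriv_succ_apply_left, hi]
    have : fderiv ℝ (fun x => a ^ i • iteratedFDeriv ℝ i f (a • x)) x
        = a ^ i • fderiv ℝ (fun x => iteratedFDeriv ℝ i f (a • x)) x :=
      congrFun (fderiv_const_smul_field (𝕜 := ℝ)
        (f := fun x => iteratedFDeriv ℝ i f (a • x)) (a ^ i)) x
    rw [this, fderiv_comp_smul, smul_smul, ← pow_succ]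
    simp [iteratedFDeriv_succ_apply_left]

/-- Iterated derivatives of `‖x‖ ^ γ` are bounded by the homogeneous weight `‖x‖ ^ (γ - k)`. -/
theorem exists_norm_iteratedFDeriv_norm_rpow_le {E : Type*} [NormedAddCommGroup E]
    [InnerProductSpace ℝ E] [FiniteDimensional ℝ E] (γ : ℝ) (k : ℕ) :
    ∃ C : ℝ, ∀ x : E, x ≠ 0 →
      ‖iteratedFDeriv ℝ k (fun y : E => ‖y‖ ^ γ) x‖ ≤ C * ‖x‖ ^ (γ - (k : ℝ)) := by
  obtain ⟨C, hC⟩ := (isCompact_sphere (0 : E) 1).exists_bound_of_continuousOn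
    (f := iteratedFDeriv ℝ k (fun y : E => ‖y‖ ^ γ)) fun x hx =>
      (((contDiffAt_norm_rpow γ (m := k) (ne_zero_of_mem_unit_sphere ⟨x, hx⟩)).iteratedFDeriv_right
        (m := 0) (by simp)).continuousAt).continuousWithinAt
  refine ⟨C, fun x hx => ?_⟩
  have hr : 0 < ‖x‖ := norm_pos_iff.mpr hx
  have hscale : (fun y : E => ‖‖x‖⁻¹ • y‖ ^ γ) = fun y : E => (‖x‖⁻¹ ^ γ) • ‖y‖ ^ γ := by
    funext y
    rw [norm_smul, norm_inv, norm_norm, Real.mul_rpow (by positivity) (by positivity), smul_eq_mul]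
  have h := congrFun
    (iteratedFDeriv_comp_const_smul_apply (fun y : E => ‖y‖ ^ γ) ‖x‖⁻¹ k) x
  rw [hscale, iteratedFDeriv_const_smul_apply' (contDiffAt_norm_rpow γ hx)] at h
  have h' := congrArg norm h
  have hb := hC (‖x‖⁻¹ • x) (by simp [norm_smul, hr.ne'])
  rw [norm_smul, norm_smul, Real.norm_of_nonneg (by positivity),
    Real.norm_of_nonneg (by positivity), Real.inv_rpow hr.le, inv_pow] at h'
  rw [Real.rpow_sub hr, Real.rpow_natCast]
  have hγ : 0 < ‖x‖ ^ γ := Real.rpow_pos_of_pos hr γ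
  calc _ = ‖x‖ ^ γ * ((‖x‖ ^ γ)⁻¹ * ‖iteratedFDeriv ℝ k (fun y : E => ‖y‖ ^ γ) x‖) := by
        field_simp
    _ ≤ ‖x‖ ^ γ * ((‖x‖ ^ k)⁻¹ * C) := by rw [h']; gcongr
    _ = _ := by ring

/-- Increments of a function that is smooth away from the origin, based at points of an annulus:
the derivatives of order `k` of the increment `ξ` are controlled by `‖ξ‖ ^ (γ - k)`. -/
theorem exists_norm_iteratedFDeriv_increment_le {E F : Type*} [NormedAddCommGroup E]
    [NormedSpace ℝ E] [FiniteDimensional ℝ E] [NormedAddCommGroup F] [NormedSpace ℝ F]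
    {G : E → F} (hG : ∀ x : E, x ≠ 0 → ∀ m : ℕ, ContDiffAt ℝ m G x)
    {γ : ℝ} (hγ1 : γ ≤ 1) (k : ℕ) :
    ∃ C : ℝ, ∀ ξ η : E, 0 < ‖ξ‖ → ‖ξ‖ ≤ 1 / 100 → 1 / 2 ≤ ‖η‖ → ‖η‖ ≤ 2 →
      ‖iteratedFDeriv ℝ k (fun ξ' => G η - G (ξ' + η)) ξ‖ ≤ C * ‖ξ‖ ^ (γ - (k : ℝ)) := by
  have hK : IsCompact (Metric.closedBall (0 : E) 3 \ Metric.ball 0 (1 / 4)) :=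
    (isCompact_closedBall _ _).diff Metric.isOpen_ball
  have hmem : ∀ ξ η : E, ‖ξ‖ ≤ 1 / 100 → 1 / 2 ≤ ‖η‖ → ‖η‖ ≤ 2 →
      ξ + η ∈ Metric.closedBall (0 : E) 3 \ Metric.ball 0 (1 / 4) := by
    intro ξ η h1 h2 h3
    have h4 := norm_add_le ξ η
    have h5 := norm_sub_le (ξ + η) ξ
    rw [add_sub_cancel_left] at h5
    simp only [Set.mem_sdiff, mem_closedBall_zero_iff, mem_ball_zero_iff, not_lt]
    constructor <;> linarith
  have hne : ∀ x ∈ Metric.closedBall (0 : E) 3 \ Metric.ball 0 (1 / 4), x ≠ 0 := by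
    rintro x ⟨-, hx⟩ rfl
    simp at hx
  have hbound : ∀ j : ℕ, ∃ C, ∀ x ∈ Metric.closedBall (0 : E) 3 \ Metric.ball 0 (1 / 4),
      ‖iteratedFDeriv ℝ j G x‖ ≤ C := fun j =>
    hK.exists_bound_of_continuousOn fun x hx =>
      (((hG x (hne x hx) j).iteratedFDeriv_right (m := 0)
        (by simp)).continuousAt).continuousWithinAt
  rcases Nat.eq_zero_or_pos k with rfl | hk
  · obtain ⟨C, hC⟩ := hbound 1
    refine ⟨C, fun ξ η h0 h1 h2 h3 => ?_⟩
    have hball : ∀ x ∈ Metric.closedBall η (1 / 100),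
        x ∈ Metric.closedBall (0 : E) 3 \ Metric.ball 0 (1 / 4) := by
      intro x hx
      simpa using hmem (x - η) η (by simpa [dist_eq_norm] using hx) h2 h3
    have hmv := (convex_closedBall η (1 / 100)).norm_image_sub_le_of_norm_fderiv_le
      (𝕜 := ℝ) (f := G) (C := C) (x := ξ + η) (y := η)
      (fun x hx => (hG x (hne x (hball x hx)) 1).differentiableAt (by simp))
      (fun x hx => by simpa using hC x (hball x hx))
      (by simpa [dist_eq_norm] using h1) (by simp)
    have hC0 : 0 ≤ C := (norm_nonneg _).trans (hC _ (hmem ξ η h1 h2 h3))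
    rw [norm_iteratedFDeriv_zero]
    refine hmv.trans ?_
    have : ‖ξ‖ ≤ ‖ξ‖ ^ γ := by
      simpa using Real.rpow_le_rpow_of_exponent_ge h0 (by linarith) hγ1
    have e : ‖η - (ξ + η)‖ = ‖ξ‖ := by simp
    rw [e]
    simpa using mul_le_mul_of_nonneg_left this hC0
  · obtain ⟨C, hC⟩ := hbound k
    refine ⟨C, fun ξ η h0 h1 h2 h3 => ?_⟩
    have hx := hmem ξ η h1 h2 h3
    have hs : ContDiffAt ℝ k (fun ξ' => G (ξ' + η)) ξ :=
      (hG _ (hne _ hx) k).comp ξ (contDiffAt_id.add contDiffAt_const)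
    have hC0 : 0 ≤ C := (norm_nonneg _).trans (hC _ hx)
    rw [fun_iteratedFDeriv_sub_apply contDiffAt_const hs, iteratedFDeriv_const_of_ne hk.ne',
      iteratedFDeriv_comp_add_right, Pi.zero_apply, zero_sub, norm_neg]
    have hk1 : (1 : ℝ) ≤ k := by exact_mod_cast hk
    have : 1 ≤ ‖ξ‖ ^ (γ - (k : ℝ)) :=
      Real.one_le_rpow_of_pos_of_le_one_of_nonpos h0 (by linarith) (by linarith)
    exact (hC _ hx).trans (le_mul_of_one_le_right hC0 this)

/-- Derivatives in `ξ` of `‖ξ‖ ^ γ`, after differentiating `l` times in an absent variable `η`. -/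
theorem exists_norm_iteratedFDeriv_iteratedFDeriv_const_le {E : Type*} [NormedAddCommGroup E]
    [InnerProductSpace ℝ E] [FiniteDimensional ℝ E] (γ : ℝ) (k l : ℕ) :
    ∃ C : ℝ, ∀ ξ η : E, ξ ≠ 0 →
      ContDiffAt ℝ k (fun ξ' : E => iteratedFDeriv ℝ l (fun _ : E => ‖ξ'‖ ^ γ) η) ξ ∧
      ‖iteratedFDeriv ℝ k
        (fun ξ' : E => iteratedFDeriv ℝ l (fun _ : E => ‖ξ'‖ ^ γ) η) ξ‖ ≤
          C * ‖ξ‖ ^ (γ - (k : ℝ)) := by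
  rcases Nat.eq_zero_or_pos l with rfl | hl
  · obtain ⟨C, hC⟩ := exists_norm_iteratedFDeriv_norm_rpow_le (E := E) γ k
    refine ⟨C, fun ξ η hξ => ?_⟩
    have e : (fun ξ' : E => iteratedFDeriv ℝ 0 (fun _ : E => ‖ξ'‖ ^ γ) η)
        = (continuousMultilinearCurryFin0 ℝ E ℝ).symm ∘ fun ξ' : E => ‖ξ'‖ ^ γ := by
      funext ξ'
      simp [iteratedFDeriv_zero_eq_comp]
    rw [e, LinearIsometryEquiv.norm_iteratedFDeriv_comp_left]
    exact ⟨(continuousMultilinearCurryFin0 ℝ E ℝ).symm.contDiff.contDiffAt.comp ξ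
      (contDiffAt_norm_rpow γ hξ), hC ξ hξ⟩
  · refine ⟨0, fun ξ η _ => ?_⟩
    simp only [iteratedFDeriv_const_of_ne hl.ne', Pi.zero_apply]
    exact ⟨contDiffAt_const, by simp⟩

/-- Symbol estimates for `σ(ξ,η) = |ξ|^γ + |η|^γ - |ξ+η|^γ` in the regime
`0 < |ξ| ≤ 1/100`, `1/2 ≤ |η| ≤ 2`: the mixed derivatives of order `k` in `ξ`
and `l` in `η` are bounded by `C |ξ|^{γ-k}`. -/
theorem phase_symbol_mixed_derivative_bound
    (n : ℕ) (hn : 1 ≤ n) (γ : ℝ) (hγ0 : 0 < γ) (hγ1 : γ < 1) (k l : ℕ) :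
    ∃ C : ℝ, 0 < C ∧
      ∀ ξ η : EuclideanSpace ℝ (Fin n),
        0 < ‖ξ‖ → ‖ξ‖ ≤ 1 / 100 → 1 / 2 ≤ ‖η‖ → ‖η‖ ≤ 2 →
        ‖iteratedFDeriv ℝ k
            (fun ξ' : EuclideanSpace ℝ (Fin n) =>
              iteratedFDeriv ℝ l
                (fun η' : EuclideanSpace ℝ (Fin n) =>
                  ‖ξ'‖ ^ γ + ‖η'‖ ^ γ - ‖ξ' + η'‖ ^ γ) η) ξ‖ ≤
          C * ‖ξ‖ ^ (γ - (k : ℝ)) := by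
  set E := EuclideanSpace ℝ (Fin n)
  set G := iteratedFDeriv ℝ l (fun y : E => ‖y‖ ^ γ) with hGdef
  have hG : ∀ x : E, x ≠ 0 → ∀ m : ℕ, ContDiffAt ℝ m G x := fun x hx m =>
    (contDiffAt_norm_rpow γ hx (m := (m + l : ℕ))).iteratedFDeriv_right (by simp)
  obtain ⟨C₁, h₁⟩ := exists_norm_iteratedFDeriv_iteratedFDeriv_const_le (E := E) γ k l
  obtain ⟨C₂, h₂⟩ := exists_norm_iteratedFDeriv_increment_le hG hγ1.le k
  refine ⟨max (C₁ + C₂) 1, by positivity, fun ξ η h0 hξ hη hη2 => ?_⟩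
  have hξ0 : ξ ≠ 0 := norm_pos_iff.mp h0
  have hη0 : η ≠ 0 := norm_pos_iff.mp (by linarith)
  have hsum : ξ + η ≠ 0 := by
    intro h
    have := congrArg norm (eq_neg_of_add_eq_zero_left h)
    rw [norm_neg] at this
    linarith
  have hev : (fun ξ' : E => iteratedFDeriv ℝ l
      (fun η' : E => ‖ξ'‖ ^ γ + ‖η'‖ ^ γ - ‖ξ' + η'‖ ^ γ) η) =ᶠ[𝓝 ξ]
      fun ξ' => iteratedFDeriv ℝ l (fun _ : E => ‖ξ'‖ ^ γ) η + (G η - G (ξ' + η)) := by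
    have hcont : ContinuousAt (fun ξ' : E => ξ' + η) ξ := by fun_prop
    filter_upwards [hcont.eventually_ne hsum] with ξ' hξ'
    have hs : ContDiffAt ℝ l (fun η' : E => ‖ξ' + η'‖ ^ γ) η :=
      (contDiffAt_norm_rpow γ hξ').comp η (contDiffAt_const.add contDiffAt_id)
    have hp : ContDiffAt ℝ l (fun η' : E => ‖η'‖ ^ γ) η := contDiffAt_norm_rpow γ hη0
    rw [fun_iteratedFDeriv_sub_apply (contDiffAt_const.add hp) hs,
      fun_iteratedFDeriv_add_apply contDiffAt_const hp,
      iteratedFDeriv_comp_add_left (f := fun y : E => ‖y‖ ^ γ), add_sub_assoc]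
  have hinc : ContDiffAt ℝ k (fun ξ' => G η - G (ξ' + η)) ξ :=
    contDiffAt_const.sub ((hG _ hsum k).comp ξ (contDiffAt_id.add contDiffAt_const))
  obtain ⟨hsm, hle⟩ := h₁ ξ η hξ0
  rw [(hev.iteratedFDeriv ℝ k).eq_of_nhds, fun_iteratedFDeriv_add_apply hsm hinc]
  calc _ ≤ C₁ * ‖ξ‖ ^ (γ - (k : ℝ)) + C₂ * ‖ξ‖ ^ (γ - (k : ℝ)) :=
        (norm_add_le _ _).trans (add_le_add hle (h₂ ξ η h0 hξ hη hη2))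
    _ = (C₁ + C₂) * ‖ξ‖ ^ (γ - (k : ℝ)) := by ring
    _ ≤ _ := by gcongr; exact le_max_left _ _
end

section
/- Let n ≥ 1, 0 < γ < 1, and let φ be a smooth compactly supported function on ℝⁿ with support contained in the annulus {ξ : 1/2 ≤ |ξ| ≤ 2}. Then there exist constants C > 0 and c > 0, depending only on (γ, n, φ), such that for all t > 0: ∫_{ℝⁿ} |𝓕^{−1}(ξ ↦ e^{−t|ξ|^γ} φ(ξ))(x)| dx ≤ C e^{−c t}. -/
open MeasureTheory
open scoped RealInnerProductSpace

open Function Set Filter Topology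
open scoped FourierTransform SchwartzMap ContDiff

section ExponentialDamping

variable {E : Type*} [NormedAddCommGroup E] [NormedSpace ℝ E]

theorem exists_norm_iteratedFDeriv_exp_neg_mul_le {ψ : E → ℝ} (hψ : ContDiff ℝ ∞ ψ)
    {K : Set E} (hK : IsCompact K) (k : ℕ) :
    ∃ C : ℝ, 0 ≤ C ∧ ∀ t : ℝ, 0 ≤ t → ∀ x ∈ K, ∀ i ≤ k,
      ‖iteratedFDeriv ℝ i (fun y ↦ Real.exp (-t * ψ y)) x‖
        ≤ C * (1 + t) ^ k * Real.exp (-t * ψ x) := by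
  have hb : ∀ i : ℕ, ∃ M : ℝ, ∀ x ∈ K, ‖iteratedFDeriv ℝ i ψ x‖ ≤ M := fun i ↦
    hK.exists_bound_of_continuousOn
      (hψ.continuous_iteratedFDeriv (by exact_mod_cast le_top)).continuousOn
  choose M hM using hb
  set A : ℝ := 1 + ∑ i ∈ Finset.range (k + 1), |M i|
  have hA1 : 1 ≤ A := by
    have : 0 ≤ ∑ i ∈ Finset.range (k + 1), |M i| := Finset.sum_nonneg fun _ _ ↦ abs_nonneg _
    linarith
  have hMA : ∀ i ≤ k, ∀ x ∈ K, ‖iteratedFDeriv ℝ i ψ x‖ ≤ A := fun i hi x hx ↦ by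
    have h1 := Finset.single_le_sum (f := fun i ↦ |M i|) (fun _ _ ↦ abs_nonneg _)
      (Finset.mem_range.2 (Nat.lt_succ_of_le hi))
    have h2 := hM i x hx
    have h3 := le_abs_self (M i)
    linarith
  refine ⟨k.factorial * A ^ k, by positivity, fun t ht x hx i hi ↦ ?_⟩
  have hD : 1 ≤ A * (1 + t) := by nlinarith
  have hψt : ContDiff ℝ ∞ (fun y ↦ -t * ψ y) := contDiff_const.mul hψ
  have key := norm_iteratedFDeriv_comp_le (n := i) (C := Real.exp (-t * ψ x))
    (D := A * (1 + t)) Real.contDiff_exp (hψt) (by exact_mod_cast le_top) x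
    (fun j _ ↦ by
      rw [norm_iteratedFDeriv_eq_norm_iteratedDeriv, iteratedDeriv_eq_iterate,
        Real.iter_deriv_exp, Real.norm_eq_abs, Real.abs_exp])
    (fun j hj hji ↦ by
      have h1 : iteratedFDeriv ℝ j (fun y ↦ -t * ψ y) x = (-t) • iteratedFDeriv ℝ j ψ x :=
        iteratedFDeriv_const_smul_apply (a := -t)
          (hψ.contDiffAt.of_le (by exact_mod_cast le_top))
      rw [h1, norm_smul, norm_neg, Real.norm_of_nonneg ht]
      calc t * ‖iteratedFDeriv ℝ j ψ x‖ ≤ (1 + t) * A := by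
            gcongr
            · linarith
            · exact hMA j (hji.trans hi) x hx
        _ = A * (1 + t) := mul_comm _ _
        _ ≤ (A * (1 + t)) ^ j := le_self_pow₀ hD (by omega))
  calc _ ≤ i.factorial * Real.exp (-t * ψ x) * (A * (1 + t)) ^ i := key
    _ ≤ k.factorial * Real.exp (-t * ψ x) * (A * (1 + t)) ^ k := by
        gcongr
    _ = _ := by rw [mul_pow]; ring

theorem exists_norm_iteratedFDeriv_exp_neg_mul_mul_le {ψ φ : E → ℝ} (hψ : ContDiff ℝ ∞ ψ)
    (hφ : ContDiff ℝ ∞ φ) (hφc : HasCompactSupport φ) {c : ℝ} (hc : ∀ x ∈ tsupport φ, c ≤ ψ x)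
    (k : ℕ) :
    ∃ C : ℝ, 0 ≤ C ∧ ∀ t : ℝ, 0 ≤ t → ∀ x,
      ‖iteratedFDeriv ℝ k (fun y ↦ Real.exp (-t * ψ y) * φ y) x‖
        ≤ C * (1 + t) ^ k * Real.exp (-c * t) := by
  obtain ⟨C, hC0, hC⟩ := exists_norm_iteratedFDeriv_exp_neg_mul_le hψ hφc.isCompact k
  have hb : ∀ i : ℕ, ∃ B : ℝ, ∀ x, ‖iteratedFDeriv ℝ i φ x‖ ≤ B := fun i ↦
    (hφc.iteratedFDeriv i).exists_bound_of_continuous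
      (hφ.continuous_iteratedFDeriv (by exact_mod_cast le_top))
  choose B hB using hb
  have hB0 : ∀ i, 0 ≤ B i := fun i ↦ (norm_nonneg _).trans (hB i 0)
  refine ⟨∑ i ∈ Finset.range (k + 1), k.choose i * C * B (k - i),
    Finset.sum_nonneg fun i _ ↦ by have := hB0 (k - i); positivity, fun t ht x ↦ ?_⟩
  by_cases hx : x ∈ tsupport φ
  · have hexp : ContDiff ℝ ∞ (fun y ↦ Real.exp (-t * ψ y)) := (contDiff_const.mul hψ).exp
    refine (norm_iteratedFDeriv_mul_le hexp hφ x (by exact_mod_cast le_top)).trans ?_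
    rw [Finset.sum_mul, Finset.sum_mul]
    refine Finset.sum_le_sum fun i hi ↦ ?_
    have h1 := hC t ht x hx i (Nat.lt_succ_iff.1 (Finset.mem_range.1 hi))
    have h2 : Real.exp (-t * ψ x) ≤ Real.exp (-c * t) :=
      Real.exp_le_exp.2 (by nlinarith [hc x hx])
    calc _ ≤ k.choose i * (C * (1 + t) ^ k * Real.exp (-c * t)) * B (k - i) := by
          gcongr
          · exact h1.trans (by gcongr)
          · exact hB _ _
      _ = _ := by ring
  · have hsub : tsupport (fun y ↦ Real.exp (-t * ψ y) * φ y) ⊆ tsupport φ :=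
      tsupport_mul_subset_right
    rw [notMem_support.1 fun h ↦ hx (hsub (support_iteratedFDeriv_subset k h)), norm_zero]
    have := Finset.sum_nonneg (s := Finset.range (k + 1))
      (f := fun i ↦ k.choose i * C * B (k - i)) fun i _ ↦ by have := hB0 (k - i); positivity
    positivity

theorem exists_one_add_pow_mul_exp_le {c : ℝ} (hc : 0 < c) (k : ℕ) :
    ∃ C : ℝ, 0 ≤ C ∧ ∀ t : ℝ, 0 ≤ t → (1 + t) ^ k ≤ C * Real.exp (c * t) := by
  refine ⟨k.factorial * c⁻¹ ^ k * Real.exp c, by positivity, fun t ht ↦ ?_⟩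
  have h := Real.pow_div_factorial_le_exp (x := c * (1 + t)) (by positivity) k
  rw [div_le_iff₀ (by positivity), mul_add, mul_one, Real.exp_add] at h
  calc (1 + t) ^ k = c⁻¹ ^ k * (c + c * t) ^ k := by
        rw [← mul_pow]; congr 1; field_simp
    _ ≤ c⁻¹ ^ k * (Real.exp c * Real.exp (c * t) * k.factorial) := by gcongr
    _ = _ := by ring

/-- The function `e^{-tψ} φ` as a complex-valued Schwartz function. -/
noncomputable def dampedSchwartz {ψ φ : E → ℝ} (hψ : ContDiff ℝ ∞ ψ) (hφ : ContDiff ℝ ∞ φ)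
    (hφc : HasCompactSupport φ) (t : ℝ) : 𝓢(E, ℂ) :=
  HasCompactSupport.toSchwartzMap (f := fun x ↦ ((Real.exp (-t * ψ x) * φ x : ℝ) : ℂ))
    ((hφc.mul_left (f := fun x ↦ Real.exp (-t * ψ x))).comp_left Complex.ofReal_zero)
    (Complex.ofRealCLM.contDiff.comp ((contDiff_const.mul hψ).exp.mul hφ))

theorem exists_seminorm_dampedSchwartz_le {ψ φ : E → ℝ} (hψ : ContDiff ℝ ∞ ψ)
    (hφ : ContDiff ℝ ∞ φ) (hφc : HasCompactSupport φ) {c : ℝ} (hc0 : 0 < c)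
    (hc : ∀ x ∈ tsupport φ, c ≤ ψ x) (m k : ℕ) :
    ∃ C : ℝ, ∀ t : ℝ, 0 ≤ t →
      SchwartzMap.seminorm ℂ m k (dampedSchwartz hψ hφ hφc t) ≤ C * Real.exp (-(c / 2) * t) := by
  obtain ⟨C, hC0, hC⟩ := exists_norm_iteratedFDeriv_exp_neg_mul_mul_le hψ hφ hφc hc k
  obtain ⟨D, hD0, hD⟩ := exists_one_add_pow_mul_exp_le (half_pos hc0) k
  obtain ⟨R, hR⟩ := hφc.isCompact.isBounded.exists_norm_le
  refine ⟨|R| ^ m * (C * D), fun t ht ↦ SchwartzMap.seminorm_le_bound ℂ m k _ (by positivity)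
    fun x ↦ ?_⟩
  have hcoe : ⇑(dampedSchwartz hψ hφ hφc t) =
      Complex.ofRealLI ∘ (fun y ↦ Real.exp (-t * ψ y) * φ y) := rfl
  have hsm : ContDiff ℝ ∞ (fun y ↦ Real.exp (-t * ψ y) * φ y) :=
    (contDiff_const.mul hψ).exp.mul hφ
  rw [hcoe, Complex.ofRealLI.norm_iteratedFDeriv_comp_left hsm.contDiffAt
    (by exact_mod_cast le_top)]
  by_cases hx : x ∈ tsupport φ
  · have hexp : Real.exp (c / 2 * t) * Real.exp (-c * t) = Real.exp (-(c / 2) * t) := by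
      rw [← Real.exp_add]; congr 1; ring
    calc _ ≤ |R| ^ m * (C * (1 + t) ^ k * Real.exp (-c * t)) := by
          gcongr
          · exact (hR x hx).trans (le_abs_self R)
          · exact hC t ht x
      _ ≤ |R| ^ m * (C * (D * Real.exp (c / 2 * t)) * Real.exp (-c * t)) := by
          gcongr
          exact hD t ht
      _ = |R| ^ m * (C * D) * (Real.exp (c / 2 * t) * Real.exp (-c * t)) := by ring
      _ = _ := by rw [hexp]
  · have hsub : tsupport (fun y ↦ Real.exp (-t * ψ y) * φ y) ⊆ tsupport φ :=
      tsupport_mul_subset_right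
    rw [notMem_support.1 fun h ↦ hx (hsub (support_iteratedFDeriv_subset k h)), norm_zero]
    simp only [mul_zero]
    positivity

end ExponentialDamping

section FourierBound

variable {E : Type*} [NormedAddCommGroup E] [InnerProductSpace ℝ E] [FiniteDimensional ℝ E]
  [MeasurableSpace E] [BorelSpace E]

theorem exists_integral_norm_fourierInv_dampedSchwartz_le {ψ φ : E → ℝ} (hψ : ContDiff ℝ ∞ ψ)
    (hφ : ContDiff ℝ ∞ φ) (hφc : HasCompactSupport φ) {c : ℝ} (hc0 : 0 < c)
    (hc : ∀ x ∈ tsupport φ, c ≤ ψ x) :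
    ∃ C : ℝ, ∀ t : ℝ, 0 ≤ t →
      ∫ x, ‖(𝓕⁻ (dampedSchwartz hψ hφ hφc t) : 𝓢(E, ℂ)) x‖ ≤ C * Real.exp (-(c / 2) * t) := by
  let L : 𝓢(E, ℂ) →L[ℂ] Lp ℂ 1 (volume : Measure E) :=
    (SchwartzMap.toLpCLM ℂ ℂ 1 volume).comp (FourierTransform.fourierInvCLM ℂ 𝓢(E, ℂ))
  let g : ℝ → 𝓢(E, ℂ) := fun t ↦
    ((Real.exp (c / 2 * t) : ℝ) : ℂ) • dampedSchwartz hψ hφ hφc t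
  have hbdd : Bornology.IsVonNBounded ℂ (g '' Ici 0) := by
    rw [(schwartz_withSeminorms ℂ E ℂ).image_isVonNBounded_iff_seminorm_bounded]
    rintro ⟨m, k⟩
    obtain ⟨C, hC⟩ := exists_seminorm_dampedSchwartz_le hψ hφ hφc hc0 hc m k
    refine ⟨|C| + 1, by positivity, fun t ht ↦ ?_⟩
    have h1 : (SchwartzMap.seminorm ℂ m k) (g t) ≤ C := by
      rw [map_smul_eq_mul, Complex.norm_real, Real.norm_of_nonneg (Real.exp_nonneg _)]
      calc _ ≤ Real.exp (c / 2 * t) * (C * Real.exp (-(c / 2) * t)) := by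
            gcongr
            exact hC t ht
        _ = C * (Real.exp (c / 2 * t) * Real.exp (-(c / 2) * t)) := by ring
        _ = C := by rw [← Real.exp_add]; simp
    exact lt_of_le_of_lt h1 (by linarith [le_abs_self C])
  obtain ⟨C, hC⟩ := (NormedSpace.isVonNBounded_iff' ℂ).1 (hbdd.image L)
  refine ⟨C, fun t ht ↦ ?_⟩
  have h := hC _ (mem_image_of_mem L (mem_image_of_mem g ht))
  have hL : ‖L (dampedSchwartz hψ hφ hφc t)‖ =
      ∫ x, ‖(𝓕⁻ (dampedSchwartz hψ hφ hφc t) : 𝓢(E, ℂ)) x‖ := SchwartzMap.norm_toLp_one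
  rw [map_smul, norm_smul, Complex.norm_real, Real.norm_of_nonneg (Real.exp_nonneg _), hL] at h
  rw [neg_mul, Real.exp_neg, ← div_eq_mul_inv, le_div_iff₀ (Real.exp_pos _), mul_comm]
  exact h

theorem fourierInv_two_pi_inv_smul (f : E → ℂ) (x : E) :
    𝓕⁻ f ((2 * Real.pi)⁻¹ • x) = ∫ ξ, f ξ * Complex.exp (Complex.I * (⟪x, ξ⟫ : ℂ)) := by
  rw [Real.fourierInv_eq']
  refine integral_congr_ae (Eventually.of_forall fun ξ ↦ ?_)
  have hpi : (2 * Real.pi) * ((2 * Real.pi)⁻¹ * ⟪x, ξ⟫) = ⟪x, ξ⟫ := by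
    field_simp
  simp only [inner_smul_right, real_inner_comm x ξ, hpi, smul_eq_mul]
  rw [mul_comm, mul_comm Complex.I]

end FourierBound

theorem exists_contDiff_eq_norm_rpow {E : Type*} [NormedAddCommGroup E] [InnerProductSpace ℝ E]
    [FiniteDimensional ℝ E] (γ : ℝ) {r : ℝ} (hr : 0 < r) :
    ∃ ψ : E → ℝ, ContDiff ℝ ∞ ψ ∧ ∀ x, r ≤ ‖x‖ → ψ x = ‖x‖ ^ γ := by
  let b : ContDiffBump (0 : E) := ⟨r / 2, r, by positivity, by linarith⟩
  refine ⟨fun x ↦ (1 - b x) * ‖x‖ ^ γ, contDiff_iff_contDiffAt.2 fun x ↦ ?_, fun x hx ↦ ?_⟩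
  · rcases eq_or_ne x 0 with rfl | hx
    · refine (contDiffAt_const (c := (0 : ℝ))).congr_of_eventuallyEq ?_
      filter_upwards [b.eventuallyEq_one] with y hy
      simp [hy]
    · exact (contDiffAt_const.sub b.contDiffAt).mul
        ((contDiffAt_norm ℝ hx).rpow_const_of_ne (norm_ne_zero_iff.2 hx))
  · have : b x = 0 := b.zero_of_le_dist (by simpa using hx)
    simp [this]

/-- Exponential-in-time `L¹` bound for the kernel of the fractional heat semigroup localized to
a frequency annulus: `‖𝓕⁻¹(e^{-t|ξ|^γ} φ(ξ))‖_{L¹} ≤ C e^{-ct}` for all `t > 0`, where `φ` is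
smooth, compactly supported in `{1/2 ≤ |ξ| ≤ 2}`. -/
theorem fractional_heat_kernel_L1_decay_on_annulus
    (n : ℕ) (hn : 1 ≤ n) (γ : ℝ) (hγ0 : 0 < γ) (hγ1 : γ < 1)
    (φ : EuclideanSpace ℝ (Fin n) → ℝ) (hφ : ContDiff ℝ (⊤ : ℕ∞) φ)
    (hφc : HasCompactSupport φ)
    (hsupp : ∀ ξ, φ ξ ≠ 0 → 1 / 2 ≤ ‖ξ‖ ∧ ‖ξ‖ ≤ 2) :
    ∃ C c : ℝ, 0 < C ∧ 0 < c ∧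
      ∀ t : ℝ, 0 < t →
        (∫ x : EuclideanSpace ℝ (Fin n),
          ‖(((2 * Real.pi) ^ (-(n : ℝ)) : ℝ) : ℂ) *
            ∫ ξ, ((Real.exp (-t * ‖ξ‖ ^ γ) * φ ξ : ℝ) : ℂ) *
              Complex.exp (Complex.I * (⟪x, ξ⟫ : ℂ))‖) ≤ C * Real.exp (-c * t) := by
  obtain ⟨ψ, hψ, hψeq⟩ := exists_contDiff_eq_norm_rpow (E := EuclideanSpace ℝ (Fin n)) γ
    (r := 1 / 2) (by norm_num)
  have hc0 : (0 : ℝ) < (1 / 2) ^ γ := by positivity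
  have hts : ∀ x ∈ tsupport φ, 1 / 2 ≤ ‖x‖ := fun x hx ↦
    closure_minimal (t := {x | 1 / 2 ≤ ‖x‖}) (fun y hy ↦ (hsupp y hy).1)
      (isClosed_le continuous_const continuous_norm) hx
  have hc : ∀ x ∈ tsupport φ, (1 / 2 : ℝ) ^ γ ≤ ψ x := fun x hx ↦ by
    rw [hψeq x (hts x hx)]
    exact Real.rpow_le_rpow (by norm_num) (hts x hx) hγ0.le
  obtain ⟨C, hC⟩ := exists_integral_norm_fourierInv_dampedSchwartz_le hψ hφ hφc hc0 hc
  set a : ℝ := (2 * Real.pi) ^ (-(n : ℝ))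
  have ha0 : 0 ≤ a := by positivity
  refine ⟨a * ((2 * Real.pi) ^ n * |C|) + 1, (1 / 2) ^ γ / 2, by positivity, half_pos hc0,
    fun t ht ↦ ?_⟩
  have hg : ∀ ξ, ((Real.exp (-t * ‖ξ‖ ^ γ) * φ ξ : ℝ) : ℂ) = dampedSchwartz hψ hφ hφc t ξ :=
    fun ξ ↦ by
      change _ = ((Real.exp (-t * ψ ξ) * φ ξ : ℝ) : ℂ)
      rcases eq_or_ne (φ ξ) 0 with h | h
      · simp [h]
      · rw [hψeq ξ (hsupp ξ h).1]
  simp_rw [hg, ← fourierInv_two_pi_inv_smul, norm_mul, ← SchwartzMap.fourierInv_coe]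
  rw [integral_const_mul, Complex.norm_real, Real.norm_of_nonneg ha0,
    Measure.integral_comp_inv_smul volume
      (fun x ↦ ‖(𝓕⁻ (dampedSchwartz hψ hφ hφc t) : 𝓢(EuclideanSpace ℝ (Fin n), ℂ)) x‖),
    finrank_euclideanSpace_fin, abs_of_nonneg (by positivity), smul_eq_mul]
  calc _ ≤ a * ((2 * Real.pi) ^ n * (|C| * Real.exp (-((1 / 2) ^ γ / 2) * t))) := by
        gcongr
        exact (hC t ht.le).trans (by gcongr; exact le_abs_self C)
    _ = a * ((2 * Real.pi) ^ n * |C|) * Real.exp (-((1 / 2) ^ γ / 2) * t) := by ring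
    _ ≤ _ := by
        gcongr
        linarith
end

section
/- Let 0 < γ < 1 and set s = 2 − γ. There exists a constant C = C(γ) > 0 such that for all t ≥ 0 and all Schwartz functions F, G : ℝ² → ℂ, the trilinear integral I(t; G, F) := ∫_{ℝ²} ∫_{ℝ²} |ξ|^{2s} e^{−t(|η|^γ + |ξ−η|^γ − |ξ|^γ)} · ((η^⊥/|η|) · (ξ−η)) · G(η) F(ξ−η) F(−ξ) dη dξ satisfies |I(t; G, F)| ≤ C · (∫_{ℝ²} |η|^{2s} |G(η)|² dη)^{1/2} · ∫_{ℝ²} |ξ|^{2(s+γ/2)} |F(ξ)|² dξ. -/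
open scoped Classical

open MeasureTheory

/-- The kernel that dominates the symmetrized multiplier, for frequencies of sizes
`a = |ξ|`, `b = |ξ - η|`, `c = |η|`. -/
noncomputable def gevreyKernel (γ t a b c : ℝ) : ℝ :=
  (if b ≤ a then 4 * (a ^ (-(γ / 2)) * b ^ (γ / 2 - 1)) else 0) +
    (if c ≤ a then 16 * (a ^ (-γ) * c ^ (γ - 1)) else 0) +
    2 * (t * c ^ (γ - 1) * Real.exp (-(t * (1 - γ) * c ^ γ)))

theorem gevreyKernel_nonneg {γ t a b c : ℝ} (ht : 0 ≤ t) (ha : 0 ≤ a) (hb : 0 ≤ b)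
    (hc : 0 ≤ c) : 0 ≤ gevreyKernel γ t a b c := by
  unfold gevreyKernel
  have h₁ : 0 ≤ if b ≤ a then 4 * (a ^ (-(γ / 2)) * b ^ (γ / 2 - 1)) else 0 := by
    split_ifs <;> positivity
  have h₂ : 0 ≤ if c ≤ a then 16 * (a ^ (-γ) * c ^ (γ - 1)) else 0 := by
    split_ifs <;> positivity
  positivity

theorem rpow_sub_rpow_le_of_one_le {a b p : ℝ} (hb : 0 ≤ b) (ha : 0 < a) (hp : 1 ≤ p) :
    a ^ p - b ^ p ≤ p * a ^ (p - 1) * (a - b) := by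
  have h := one_add_mul_self_le_rpow_one_add (s := b / a - 1)
    (by have := div_nonneg hb ha.le; linarith) hp
  rw [show 1 + (b / a - 1) = b / a by ring, Real.div_rpow hb ha.le,
    le_div_iff₀ (Real.rpow_pos_of_pos ha p)] at h
  have h' : a ^ p = a ^ (p - 1) * a := by
    rw [← Real.rpow_add_one ha.ne']; ring_nf
  have h'' : (1 + p * (b / a - 1)) * a ^ p = a ^ p - p * a ^ (p - 1) * (a - b) := by
    rw [h']; field_simp; ring
  linarith

theorem rpow_sub_rpow_le_of_le_one {a b p : ℝ} (ha : 0 ≤ a) (hb : 0 < b) (hp0 : 0 ≤ p)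
    (hp : p ≤ 1) : a ^ p - b ^ p ≤ p * b ^ (p - 1) * (a - b) := by
  have h := rpow_one_add_le_one_add_mul_self (s := a / b - 1)
    (by have := div_nonneg ha hb.le; linarith) hp0 hp
  rw [show 1 + (a / b - 1) = a / b by ring, Real.div_rpow ha hb.le,
    div_le_iff₀ (Real.rpow_pos_of_pos hb p)] at h
  have h' : b ^ p = b ^ (p - 1) * b := by
    rw [← Real.rpow_add_one hb.ne']; ring_nf
  have h'' : (1 + p * (a / b - 1)) * b ^ p = b ^ p + p * b ^ (p - 1) * (a - b) := by
    rw [h']; field_simp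
  linarith

theorem two_mul_rpow_le {x p : ℝ} (hx : 0 ≤ x) (hp : p ≤ 2) : (2 * x) ^ p ≤ 4 * x ^ p := by
  rw [Real.mul_rpow zero_le_two hx]
  gcongr
  calc (2 : ℝ) ^ p ≤ 2 ^ (2 : ℝ) := Real.rpow_le_rpow_of_exponent_le one_le_two hp
    _ = 4 := by norm_num

/-- The multiplier without its Riesz-type factor. -/
noncomputable def gevreyWeight (γ s t a b c : ℝ) : ℝ :=
  a ^ (2 * s) * Real.exp (-t * (c ^ γ + b ^ γ - a ^ γ))

theorem gevreyWeight_nonneg {γ s t a b c : ℝ} (ha : 0 ≤ a) : 0 ≤ gevreyWeight γ s t a b c := by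
  unfold gevreyWeight; positivity

theorem gevreyWeight_le {γ s t a b c : ℝ} (hγ0 : 0 ≤ γ) (hγ1 : γ ≤ 1) (ht : 0 ≤ t) (ha : 0 ≤ a)
    (hb : 0 ≤ b) (hc : 0 ≤ c) (hac : a ≤ b + c) : gevreyWeight γ s t a b c ≤ a ^ (2 * s) := by
  unfold gevreyWeight
  have h : a ^ γ ≤ b ^ γ + c ^ γ :=
    (Real.rpow_le_rpow ha hac hγ0).trans (Real.rpow_add_le_add_rpow hb hc hγ0 hγ1)
  refine mul_le_of_le_one_right (by positivity) (Real.exp_le_one_iff.2 ?_)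
  have := mul_nonneg ht (by linarith : 0 ≤ c ^ γ + b ^ γ - a ^ γ)
  linarith

theorem mul_abs_gevreyWeight_sub_le_of_le_two_mul {γ s t a b c : ℝ} (hγ0 : 0 < γ) (hγ1 : γ < 1)
    (hs : s = 2 - γ) (ht : 0 ≤ t) (hb : 0 < b) (hc : 0 < c) (hba : b ≤ a) (hac : a ≤ b + c)
    (h : a ≤ 2 * c) :
    b * |gevreyWeight γ s t a b c - gevreyWeight γ s t b a c| ≤
      c ^ s * (b ^ (s + γ / 2) * a ^ (s + γ / 2)) *
        (4 * (a ^ (-(γ / 2)) * b ^ (γ / 2 - 1))) := by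
  have ha : 0 < a := hb.trans_le hba
  have h₁ : |gevreyWeight γ s t a b c - gevreyWeight γ s t b a c| ≤ a ^ (2 * s) :=
    abs_sub_le_of_nonneg_of_le (gevreyWeight_nonneg ha.le)
      (gevreyWeight_le hγ0.le hγ1.le ht ha.le hb.le hc.le hac) (gevreyWeight_nonneg hb.le)
      ((gevreyWeight_le hγ0.le hγ1.le ht hb.le ha.le hc.le (by linarith)).trans
        (Real.rpow_le_rpow hb.le hba (by linarith)))
  have h₂ : a ^ s ≤ 4 * c ^ s :=
    (Real.rpow_le_rpow ha.le h (by linarith)).trans (two_mul_rpow_le hc.le (by linarith))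
  have h₃ : a ^ (2 * s) = a ^ s * a ^ s := by rw [← Real.rpow_add ha]; ring_nf
  have h₄ : a ^ (s + γ / 2) * a ^ (-(γ / 2)) = a ^ s := by rw [← Real.rpow_add ha]; ring_nf
  have h₅ : b ^ (s + γ / 2) * b ^ (γ / 2 - 1) = b := by
    rw [← Real.rpow_add hb, show s + γ / 2 + (γ / 2 - 1) = 1 by linarith, Real.rpow_one]
  calc b * |gevreyWeight γ s t a b c - gevreyWeight γ s t b a c| ≤ b * (a ^ s * a ^ s) := by
        rw [← h₃]; gcongr
    _ ≤ b * (4 * c ^ s * a ^ s) := by gcongr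
    _ = (b ^ (s + γ / 2) * b ^ (γ / 2 - 1)) *
          (4 * c ^ s * (a ^ (s + γ / 2) * a ^ (-(γ / 2)))) := by rw [h₄, h₅]
    _ = _ := by ring

theorem mul_abs_gevreyWeight_sub_le_of_two_mul_le {γ s t a b c : ℝ} (hγ0 : 0 < γ) (hγ1 : γ < 1)
    (hs : s = 2 - γ) (ht : 0 ≤ t) (hb : 0 < b) (hc : 0 < c) (hba : b ≤ a) (hac : a ≤ b + c)
    (h : 2 * c ≤ a) :
    b * |gevreyWeight γ s t a b c - gevreyWeight γ s t b a c| ≤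
      c ^ s * (b ^ (s + γ / 2) * a ^ (s + γ / 2)) *
        (16 * (a ^ (-γ) * c ^ (γ - 1)) +
          2 * (t * c ^ (γ - 1) * Real.exp (-(t * (1 - γ) * c ^ γ)))) := by
  have ha : 0 < a := hb.trans_le hba
  set δ := a ^ γ - b ^ γ with hδ
  have hδ0 : 0 ≤ δ := sub_nonneg.2 (Real.rpow_le_rpow hb.le hba hγ0.le)
  have hδ1 : δ ≤ γ * b ^ (γ - 1) * c :=
    (rpow_sub_rpow_le_of_le_one ha.le hb hγ0.le hγ1.le).trans (by gcongr; linarith)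
  have hδ2 : δ ≤ γ * c ^ γ := by
    have h₁ : b ^ (γ - 1) ≤ c ^ (γ - 1) :=
      Real.rpow_le_rpow_of_nonpos hc (by linarith) (by linarith)
    have h₂ : c ^ γ = c ^ (γ - 1) * c := by rw [← Real.rpow_add_one hc.ne']; ring_nf
    calc δ ≤ γ * b ^ (γ - 1) * c := hδ1
      _ ≤ γ * c ^ (γ - 1) * c := by gcongr
      _ = γ * c ^ γ := by rw [h₂]; ring
  set e := Real.exp (-(t * (1 - γ) * c ^ γ)) with he
  have hcs : c = c ^ s * c ^ (γ - 1) := by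
    rw [← Real.rpow_add hc, show s + (γ - 1) = 1 by linarith, Real.rpow_one]
  set e₁ := Real.exp (-t * (c ^ γ + b ^ γ - a ^ γ)) with he₁
  set e₂ := Real.exp (-t * (c ^ γ + a ^ γ - b ^ γ)) with he₂
  have he₁e : e₁ ≤ e := by
    refine Real.exp_le_exp.2 ?_
    have := mul_le_mul_of_nonneg_left hδ2 ht
    rw [hδ] at this
    linarith
  have he₁1 : e₁ ≤ 1 := by
    refine he₁e.trans (Real.exp_le_one_iff.2 (neg_nonpos.2 ?_))
    have : 0 ≤ 1 - γ := by linarith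
    positivity
  have he₂₁ : e₂ = e₁ * Real.exp (-(2 * t * δ)) := by
    rw [he₁, he₂, ← Real.exp_add]; congr 1; rw [hδ]; ring
  have hexp : 1 - 2 * t * δ ≤ Real.exp (-(2 * t * δ)) := by
    have := Real.add_one_le_exp (-(2 * t * δ)); linarith
  have hdiff : e₁ - e₂ ≤ 2 * t * δ * e := by
    calc e₁ - e₂ = e₁ * (1 - Real.exp (-(2 * t * δ))) := by rw [he₂₁]; ring
      _ ≤ e₁ * (2 * t * δ) := by gcongr; linarith
      _ ≤ e * (2 * t * δ) := by gcongr
      _ = _ := by ring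
  have he₂le : e₂ ≤ e₁ := by
    refine Real.exp_le_exp.2 ?_
    have := mul_nonneg ht hδ0
    rw [hδ] at this
    linarith
  have hpow : b ^ (2 * s) ≤ a ^ (2 * s) := Real.rpow_le_rpow hb.le hba (by linarith)
  have hpow' : a ^ (2 * s) - b ^ (2 * s) ≤ 4 * a ^ (2 * s - 1) * c :=
    (rpow_sub_rpow_le_of_one_le hb.le ha (by linarith)).trans
      (by gcongr <;> linarith)
  have habs : |gevreyWeight γ s t a b c - gevreyWeight γ s t b a c| =
      (a ^ (2 * s) - b ^ (2 * s)) * e₁ + b ^ (2 * s) * (e₁ - e₂) := by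
    unfold gevreyWeight
    rw [abs_of_nonneg (sub_nonneg.2 (by gcongr))]
    ring
  have hfirst : b * ((a ^ (2 * s) - b ^ (2 * s)) * e₁) ≤
      c ^ s * (b ^ (s + γ / 2) * a ^ (s + γ / 2)) * (16 * (a ^ (-γ) * c ^ (γ - 1))) := by
    have h₁ : a * a ^ (2 * s - 1) = a ^ (s + γ / 2) * a ^ (s + γ / 2) * a ^ (-γ) := by
      rw [mul_comm, ← Real.rpow_add_one ha.ne', ← Real.rpow_add ha, ← Real.rpow_add ha]
      ring_nf
    have h₂ : a ^ (s + γ / 2) ≤ 4 * b ^ (s + γ / 2) :=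
      (Real.rpow_le_rpow ha.le (by linarith) (by linarith)).trans
        (two_mul_rpow_le hb.le (by linarith))
    calc b * ((a ^ (2 * s) - b ^ (2 * s)) * e₁)
        ≤ a * ((4 * a ^ (2 * s - 1) * c) * 1) := by
          gcongr
      _ = 4 * (a * a ^ (2 * s - 1)) * c := by ring
      _ = 4 * (a ^ (s + γ / 2) * a ^ (s + γ / 2) * a ^ (-γ)) * (c ^ s * c ^ (γ - 1)) := by
          rw [h₁, ← hcs]
      _ ≤ 4 * (4 * b ^ (s + γ / 2) * a ^ (s + γ / 2) * a ^ (-γ)) * (c ^ s * c ^ (γ - 1)) := by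
          gcongr
      _ = _ := by ring
  have hsecond : b * (b ^ (2 * s) * (e₁ - e₂)) ≤
      c ^ s * (b ^ (s + γ / 2) * a ^ (s + γ / 2)) * (2 * (t * c ^ (γ - 1) * e)) := by
    have h₁ : b * b ^ (2 * s) * b ^ (γ - 1) = b ^ (s + γ / 2) * b ^ (s + γ / 2) := by
      rw [mul_comm b, ← Real.rpow_add_one hb.ne', ← Real.rpow_add hb, ← Real.rpow_add hb]
      ring_nf
    calc b * (b ^ (2 * s) * (e₁ - e₂))
        ≤ b * (b ^ (2 * s) * (2 * t * (1 * b ^ (γ - 1) * c) * e)) := by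
          gcongr
          refine hdiff.trans ?_
          gcongr
          exact hδ1.trans (by gcongr)
      _ = (b * b ^ (2 * s) * b ^ (γ - 1)) * (2 * t * e) * c := by ring
      _ = (b ^ (s + γ / 2) * b ^ (s + γ / 2)) * (2 * t * e) * (c ^ s * c ^ (γ - 1)) := by
          rw [h₁, ← hcs]
      _ ≤ (b ^ (s + γ / 2) * a ^ (s + γ / 2)) * (2 * t * e) * (c ^ s * c ^ (γ - 1)) := by
          gcongr
          linarith
      _ = _ := by ring
  rw [habs, mul_add, mul_add]
  exact add_le_add hfirst hsecond

theorem mul_abs_gevreyWeight_sub_le {γ s t a b c : ℝ} (hγ0 : 0 < γ) (hγ1 : γ < 1)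
    (hs : s = 2 - γ) (ht : 0 ≤ t) (hb : 0 < b) (hc : 0 < c) (hba : b ≤ a) (hac : a ≤ b + c) :
    b * |gevreyWeight γ s t a b c - gevreyWeight γ s t b a c| ≤
      c ^ s * (b ^ (s + γ / 2) * a ^ (s + γ / 2)) * gevreyKernel γ t a b c := by
  have ha : 0 < a := hb.trans_le hba
  rcases le_total a (2 * c) with h | h
  · refine (mul_abs_gevreyWeight_sub_le_of_le_two_mul hγ0 hγ1 hs ht hb hc hba hac h).trans ?_
    rw [gevreyKernel, if_pos hba, add_assoc]
    gcongr
    refine le_add_of_nonneg_right (add_nonneg ?_ (by positivity))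
    split_ifs <;> positivity
  · refine (mul_abs_gevreyWeight_sub_le_of_two_mul_le hγ0 hγ1 hs ht hb hc hba hac h).trans ?_
    rw [gevreyKernel, if_pos hba, if_pos (by linarith : c ≤ a)]
    gcongr
    exact le_add_of_nonneg_left (by positivity)

local notation "Plane" => EuclideanSpace ℝ (Fin 2)

theorem lintegral_ofReal_norm_le {f : ℝ → ℝ} (hf : ∀ r, 0 ≤ f r)
    (hint : IntegrableOn (fun r => r * f r) (Set.Ioi 0)) {A : ℝ}
    (hA : ∫ r in Set.Ioi 0, r * f r ≤ A) :
    ∫⁻ x : Plane, ENNReal.ofReal (f ‖x‖) ≤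
      ENNReal.ofReal (2 * volume.real (Metric.ball (0 : Plane) 1) * A) := by
  have hi : Integrable (fun x : Plane => f ‖x‖) := by
    rw [integrable_fun_norm_addHaar]
    simpa using hint
  rw [← ofReal_integral_eq_lintegral_ofReal hi (Filter.Eventually.of_forall fun x => hf _),
    integral_fun_norm_addHaar]
  refine ENNReal.ofReal_le_ofReal ?_
  simp only [finrank_euclideanSpace, Fintype.card_fin, Nat.add_one_sub_one, pow_one, smul_eq_mul,
    nsmul_eq_mul, Nat.cast_ofNat, mul_assoc]
  gcongr

theorem lintegral_norm_rpow_of_norm_le {p a : ℝ} (hp : 0 < p) (ha : 0 ≤ a) :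
    ∫⁻ x : Plane, ENNReal.ofReal (if ‖x‖ ≤ a then a ^ (-p) * ‖x‖ ^ (p - 2) else 0) ≤
      ENNReal.ofReal (2 * volume.real (Metric.ball (0 : Plane) 1) * (1 / p)) := by
  have hEq : Set.EqOn ((Set.Ioc 0 a).indicator fun r : ℝ => a ^ (-p) * r ^ (p - 1))
      (fun r : ℝ => r * if r ≤ a then a ^ (-p) * r ^ (p - 2) else 0) (Set.Ioi 0) := by
    intro r hr
    have hr : 0 < r := hr
    by_cases h : r ≤ a
    · have : r ^ (p - 1) = r * r ^ (p - 2) := by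
        rw [mul_comm, ← Real.rpow_add_one hr.ne']; ring_nf
      simp only [Set.indicator, Set.mem_Ioc, hr, h, and_self, if_true, this]
      ring
    · simp [Set.indicator, h]
  have hI : IntegrableOn (fun r : ℝ => a ^ (-p) * r ^ (p - 1)) (Set.Ioc 0 a) :=
    ((intervalIntegrable_iff_integrableOn_Ioc_of_le ha).1
      (intervalIntegral.intervalIntegrable_rpow' (by linarith))).const_mul _
  refine lintegral_ofReal_norm_le
    (f := fun r => if r ≤ a then a ^ (-p) * |r| ^ (p - 2) else 0)
    (fun r => by split_ifs <;> positivity) ?_ ?_ |>.trans' (by simp)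
  · refine (((integrable_indicator_iff measurableSet_Ioc).2 hI).integrableOn).congr_fun
      (fun r hr => ?_) measurableSet_Ioi
    rw [hEq hr]
    simp only [abs_of_pos (Set.mem_Ioi.1 hr)]
  · have h : ∫ r in Set.Ioi 0, r * (if r ≤ a then a ^ (-p) * |r| ^ (p - 2) else 0) =
        ∫ r in Set.Ioi 0, (Set.Ioc 0 a).indicator (fun r : ℝ => a ^ (-p) * r ^ (p - 1)) r := by
      refine setIntegral_congr_fun measurableSet_Ioi fun r hr => ?_
      rw [hEq hr]
      simp only [abs_of_pos (Set.mem_Ioi.1 hr)]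
    rw [h, setIntegral_indicator measurableSet_Ioc,
      Set.inter_eq_right.2 fun x hx => hx.1, ← intervalIntegral.integral_of_le ha,
      intervalIntegral.integral_const_mul, integral_rpow (Or.inl (by linarith))]
    rw [sub_add_cancel, Real.zero_rpow hp.ne', sub_zero, mul_div_assoc']
    gcongr
    rw [Real.rpow_neg ha]
    exact inv_mul_le_one

theorem lintegral_sq_mul_rpow_mul_exp_le {γ t : ℝ} (hγ0 : 0 < γ) (hγ1 : γ < 1) (ht : 0 ≤ t) :
    ∫⁻ x : Plane, ENNReal.ofReal
        (t ^ 2 * ‖x‖ ^ (2 * γ - 2) * Real.exp (-(2 * t * (1 - γ)) * ‖x‖ ^ γ)) ≤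
      ENNReal.ofReal (2 * volume.real (Metric.ball (0 : Plane) 1) *
        (1 / (4 * (1 - γ) ^ 2 * γ))) := by
  rcases ht.eq_or_lt with rfl | ht
  · simp
  have hb : 0 < 2 * t * (1 - γ) := mul_pos (by positivity) (by linarith)
  have hEq : Set.EqOn
      (fun r : ℝ => t ^ 2 * (r ^ (2 * γ - 1) * Real.exp (-(2 * t * (1 - γ)) * r ^ γ)))
      (fun r : ℝ => r * (t ^ 2 * |r| ^ (2 * γ - 2) *
        Real.exp (-(2 * t * (1 - γ)) * r ^ γ))) (Set.Ioi 0) := by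
    intro r hr
    have hr : 0 < r := hr
    have : r ^ (2 * γ - 1) = r * r ^ (2 * γ - 2) := by
      rw [mul_comm r, ← Real.rpow_add_one hr.ne']; ring_nf
    simp only [this, abs_of_pos hr]
    ring
  refine lintegral_ofReal_norm_le
    (f := fun r => t ^ 2 * |r| ^ (2 * γ - 2) * Real.exp (-(2 * t * (1 - γ)) * r ^ γ))
    (fun r => by positivity) ?_ ?_ |>.trans' (by simp)
  · exact IntegrableOn.congr_fun
      ((integrableOn_rpow_mul_exp_neg_mul_rpow (by linarith) hγ0 hb).const_mul _) hEq
      measurableSet_Ioi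
  · rw [← setIntegral_congr_fun measurableSet_Ioi hEq, integral_const_mul,
      integral_rpow_mul_exp_neg_mul_rpow hγ0 (by linarith) hb,
      show -(2 * γ - 1 + 1) / γ = -(2 : ℕ) by field_simp; push_cast; ring,
      show (2 * γ - 1 + 1) / γ = 2 by field_simp; ring, Real.rpow_neg hb.le, Real.rpow_natCast,
      Real.Gamma_two]
    have : 1 - γ ≠ 0 := by linarith
    refine le_of_eq ?_
    field_simp
    ring

theorem gevreyKernel_sq_le {γ t a b c : ℝ} (ha : 0 ≤ a) (hb : 0 ≤ b) (hc : 0 ≤ c) :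
    gevreyKernel γ t a b c ^ 2 ≤
      48 * (if b ≤ a then a ^ (-γ) * b ^ (γ - 2) else 0) +
        768 * (if c ≤ a then a ^ (-(2 * γ)) * c ^ (2 * γ - 2) else 0) +
        12 * (t ^ 2 * c ^ (2 * γ - 2) * Real.exp (-(2 * t * (1 - γ)) * c ^ γ)) := by
  have hsq : ∀ {x : ℝ} (_ : 0 ≤ x) (p q : ℝ), q = p * 2 → x ^ q = (x ^ p) ^ 2 := by
    rintro x hx p q rfl
    rw [← Real.rpow_mul_natCast hx]; norm_num
  have h3 : ∀ x y z : ℝ, (x + y + z) ^ 2 ≤ 3 * x ^ 2 + 3 * y ^ 2 + 3 * z ^ 2 := fun x y z => by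
    nlinarith [sq_nonneg (x - y), sq_nonneg (y - z), sq_nonneg (x - z)]
  refine (h3 _ _ _).trans (le_of_eq ?_)
  rw [hsq ha (-γ) (-(2 * γ)) (by ring), hsq ha (-(γ / 2)) (-γ) (by ring),
    hsq hb (γ / 2 - 1) (γ - 2) (by ring), hsq hc (γ - 1) (2 * γ - 2) (by ring),
    show -(2 * t * (1 - γ)) * c ^ γ = (2 : ℕ) * -(t * (1 - γ) * c ^ γ) by push_cast; ring,
    Real.exp_nat_mul]
  congr 1
  · congr 1 <;> split_ifs <;> ring
  · ring

theorem exists_lintegral_gevreyKernel_sq_le {γ : ℝ} (hγ0 : 0 < γ) (hγ1 : γ < 1) :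
    ∃ A : ℝ, 0 ≤ A ∧ ∀ t : ℝ, 0 ≤ t → ∀ ξ : Plane,
      ∫⁻ η : Plane, ENNReal.ofReal (gevreyKernel γ t ‖ξ‖ ‖ξ - η‖ ‖η‖) ^ 2 ≤ ENNReal.ofReal A := by
  set B := 2 * volume.real (Metric.ball (0 : Plane) 1) with hB
  have hB0 : 0 ≤ B := by positivity
  have hγ : 0 < 1 - γ := by linarith
  refine ⟨48 * (B * (1 / γ)) + 768 * (B * (1 / (2 * γ))) +
    12 * (B * (1 / (4 * (1 - γ) ^ 2 * γ))), by positivity, fun t ht ξ => ?_⟩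
  have h₁ := lintegral_norm_rpow_of_norm_le hγ0 (norm_nonneg ξ)
  have h₂ := lintegral_norm_rpow_of_norm_le (by linarith : 0 < 2 * γ) (norm_nonneg ξ)
  have h₃ := lintegral_sq_mul_rpow_mul_exp_le hγ0 hγ1 ht
  rw [← lintegral_sub_left_eq_self _ ξ] at h₁
  have hite : ∀ {p : Prop} [Decidable p] {x : ℝ}, 0 ≤ x → 0 ≤ if p then x else 0 := by
    intro p _ x hx; split_ifs <;> simp [hx]
  have hm : ∀ (p : ℝ) (u : Plane → Plane), Measurable u → Measurable fun η : Plane =>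
      ENNReal.ofReal (if ‖u η‖ ≤ ‖ξ‖ then ‖ξ‖ ^ (-p) * ‖u η‖ ^ (p - 2) else 0) := fun p u hu =>
    (Measurable.ite (measurableSet_le (by fun_prop) (by fun_prop)) (by fun_prop)
      (by fun_prop)).ennreal_ofReal
  calc ∫⁻ η : Plane, ENNReal.ofReal (gevreyKernel γ t ‖ξ‖ ‖ξ - η‖ ‖η‖) ^ 2
      ≤ ∫⁻ η : Plane, (ENNReal.ofReal 48 * ENNReal.ofReal
            (if ‖ξ - η‖ ≤ ‖ξ‖ then ‖ξ‖ ^ (-γ) * ‖ξ - η‖ ^ (γ - 2) else 0) +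
          ENNReal.ofReal 768 * ENNReal.ofReal
            (if ‖η‖ ≤ ‖ξ‖ then ‖ξ‖ ^ (-(2 * γ)) * ‖η‖ ^ (2 * γ - 2) else 0) +
          ENNReal.ofReal 12 * ENNReal.ofReal
            (t ^ 2 * ‖η‖ ^ (2 * γ - 2) * Real.exp (-(2 * t * (1 - γ)) * ‖η‖ ^ γ))) := by
        refine lintegral_mono fun η => ?_
        rw [← ENNReal.ofReal_pow
            (gevreyKernel_nonneg ht (norm_nonneg _) (norm_nonneg _) (norm_nonneg _)),
          ← ENNReal.ofReal_mul (by norm_num), ← ENNReal.ofReal_mul (by norm_num),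
          ← ENNReal.ofReal_mul (by norm_num),
          ← ENNReal.ofReal_add (mul_nonneg (by norm_num) (hite (by positivity)))
            (mul_nonneg (by norm_num) (hite (by positivity))),
          ← ENNReal.ofReal_add (add_nonneg (mul_nonneg (by norm_num) (hite (by positivity)))
            (mul_nonneg (by norm_num) (hite (by positivity)))) (by positivity)]
        exact ENNReal.ofReal_le_ofReal
          (gevreyKernel_sq_le (norm_nonneg _) (norm_nonneg _) (norm_nonneg _))
    _ ≤ _ := by
        have m₁ := hm γ (fun η => ξ - η) (by fun_prop)
        have m₂ := hm (2 * γ) (fun η => η) measurable_id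
        have m₃ : Measurable fun η : Plane => ENNReal.ofReal
            (t ^ 2 * ‖η‖ ^ (2 * γ - 2) * Real.exp (-(2 * t * (1 - γ)) * ‖η‖ ^ γ)) := by fun_prop
        rw [lintegral_add_right _ (m₃.const_mul _),
          lintegral_add_left (m₁.const_mul _), lintegral_const_mul _ m₁, lintegral_const_mul _ m₂,
          lintegral_const_mul _ m₃, ENNReal.ofReal_add (by positivity) (by positivity),
          ENNReal.ofReal_add (by positivity) (by positivity),
          ENNReal.ofReal_mul (p := 48) (by norm_num), ENNReal.ofReal_mul (p := 768) (by norm_num),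
          ENNReal.ofReal_mul (p := 12) (by norm_num)]
        exact add_le_add (add_le_add (mul_le_mul' le_rfl h₁) (mul_le_mul' le_rfl h₂))
          (mul_le_mul' le_rfl h₃)

theorem lintegral_trilinear_le {K : Plane → Plane → ENNReal}
    (hK : Measurable (Function.uncurry K)) {f g : Plane → ENNReal} (hf : Measurable f)
    (hg : Measurable g) {A : ENNReal} (hA : ∀ ξ, ∫⁻ η, K ξ η ^ 2 ≤ A) :
    ∫⁻ η, ∫⁻ ξ, K ξ η * (g η * f (ξ - η) * f (-ξ)) ≤
      A ^ (1 / 2 : ℝ) * (∫⁻ η, g η ^ 2) ^ (1 / 2 : ℝ) * ∫⁻ ξ, f ξ ^ 2 := by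
  have hK' : Measurable fun p : Plane × Plane => K p.2 p.1 := hK.comp measurable_swap
  have hu : Measurable fun p : Plane × Plane => g p.1 * f (p.2 - p.1) := by fun_prop
  have hw : Measurable fun p : Plane × Plane => K p.2 p.1 * f (-p.2) := by fun_prop
  have h₁ : ∫⁻ p : Plane × Plane, (g p.1 * f (p.2 - p.1)) ^ 2 =
      (∫⁻ η, g η ^ 2) * ∫⁻ ξ, f ξ ^ 2 := by
    rw [Measure.volume_eq_prod, lintegral_prod _ (by fun_prop),
      ← lintegral_mul_const _ (by fun_prop)]
    refine lintegral_congr fun η => ?_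
    simp only [mul_pow]
    rw [lintegral_const_mul _ (by fun_prop),
      lintegral_sub_right_eq_self (fun ξ => f ξ ^ 2) η]
  have h₂ : ∫⁻ p : Plane × Plane, (K p.2 p.1 * f (-p.2)) ^ 2 ≤ A * ∫⁻ ξ, f ξ ^ 2 := by
    rw [Measure.volume_eq_prod, lintegral_prod_symm _ (by fun_prop),
      ← lintegral_neg_eq_self (fun ξ => f ξ ^ 2), ← lintegral_const_mul _ (by fun_prop)]
    refine lintegral_mono fun ξ => ?_
    have hKξ : Measurable (K ξ) := hK.comp measurable_prodMk_left
    simp only [mul_pow]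
    rw [lintegral_mul_const _ (hKξ.pow_const 2)]
    gcongr
    exact hA ξ
  have h := ENNReal.lintegral_mul_le_Lp_mul_Lq (volume : Measure (Plane × Plane))
    Real.HolderConjugate.two_two hu.aemeasurable hw.aemeasurable
  simp only [ENNReal.rpow_two, Pi.mul_apply] at h
  calc ∫⁻ η, ∫⁻ ξ, K ξ η * (g η * f (ξ - η) * f (-ξ))
      = ∫⁻ p : Plane × Plane, g p.1 * f (p.2 - p.1) * (K p.2 p.1 * f (-p.2)) := by
        rw [Measure.volume_eq_prod, lintegral_prod _ (by fun_prop)]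
        refine lintegral_congr fun η => lintegral_congr fun ξ => ?_
        ring
    _ ≤ _ := h
    _ ≤ ((∫⁻ η, g η ^ 2) * ∫⁻ ξ, f ξ ^ 2) ^ (1 / 2 : ℝ) *
          (A * ∫⁻ ξ, f ξ ^ 2) ^ (1 / 2 : ℝ) := by
        rw [h₁]; gcongr
    _ = A ^ (1 / 2 : ℝ) * (∫⁻ η, g η ^ 2) ^ (1 / 2 : ℝ) *
          ((∫⁻ ξ, f ξ ^ 2) ^ (1 / 2 : ℝ) * (∫⁻ ξ, f ξ ^ 2) ^ (1 / 2 : ℝ)) := by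
        rw [ENNReal.mul_rpow_of_nonneg _ _ (by norm_num),
          ENNReal.mul_rpow_of_nonneg _ _ (by norm_num)]
        ring
    _ = _ := by
        rw [← ENNReal.rpow_add_of_nonneg _ _ (by norm_num) (by norm_num)]
        norm_num

/-- The factor `(η^⊥ / |η|) · (ξ - η)`. -/
noncomputable def rieszFactor (ξ η : Plane) : ℝ :=
  if η = 0 then 0 else (-(η 1) * ((ξ - η) 0) + η 0 * ((ξ - η) 1)) / ‖η‖

theorem rieszFactor_sub (ξ η : Plane) : rieszFactor (η - ξ) η = -rieszFactor ξ η := by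
  unfold rieszFactor
  split_ifs
  · simp
  · simp only [PiLp.sub_apply]
    ring

theorem abs_rieszFactor_le (ξ η : Plane) : |rieszFactor ξ η| ≤ ‖ξ - η‖ := by
  unfold rieszFactor
  split_ifs with h
  · simp
  · have hη : 0 < ‖η‖ := norm_pos_iff.2 h
    rw [abs_div, abs_of_pos hη, div_le_iff₀ hη]
    refine abs_le_of_sq_le_sq ?_ (by positivity)
    rw [mul_pow, EuclideanSpace.real_norm_sq_eq, EuclideanSpace.real_norm_sq_eq,
      Fin.sum_univ_two, Fin.sum_univ_two]
    nlinarith [sq_nonneg (η 0 * (ξ - η) 0 + η 1 * (ξ - η) 1)]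

theorem measurable_rieszFactor : Measurable (Function.uncurry rieszFactor) := by
  refine Measurable.ite (measurable_snd (measurableSet_singleton 0)) measurable_const ?_
  refine Measurable.div (Continuous.measurable ?_) (by fun_prop)
  fun_prop

theorem measurable_gevreyKernel (γ t : ℝ) : Measurable (Function.uncurry fun ξ η : Plane =>
    ENNReal.ofReal (gevreyKernel γ t ‖ξ‖ ‖ξ - η‖ ‖η‖)) := by
  refine Measurable.ennreal_ofReal (Measurable.add (Measurable.add ?_ ?_) (by fun_prop))
  · exact Measurable.ite (measurableSet_le (by fun_prop) (by fun_prop)) (by fun_prop)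
      (by fun_prop)
  · exact Measurable.ite (measurableSet_le (by fun_prop) (by fun_prop)) (by fun_prop)
      (by fun_prop)

theorem SchwartzMap.integrable_rpow_mul_norm (F : SchwartzMap Plane ℂ) {p : ℝ} (hp0 : 0 ≤ p)
    (hp : p ≤ 4) : Integrable fun x : Plane => ‖x‖ ^ p * ‖F x‖ := by
  refine ((F.integrable_pow_mul volume 0).add (F.integrable_pow_mul volume 4)).mono'
    (by have := F.continuous.measurable; fun_prop) (Filter.Eventually.of_forall fun x => ?_)
  rw [Real.norm_of_nonneg (by positivity), Pi.add_apply, ← add_mul, pow_zero]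
  gcongr
  rcases le_total ‖x‖ 1 with h | h
  · have := Real.rpow_le_one (norm_nonneg x) h hp0
    have : 0 ≤ ‖x‖ ^ 4 := by positivity
    linarith
  · have := Real.rpow_le_rpow_of_exponent_le h hp
    rw [show (4 : ℝ) = (4 : ℕ) by norm_num, Real.rpow_natCast] at this
    linarith

theorem SchwartzMap.exists_pow_mul_norm_le (F : SchwartzMap Plane ℂ) (k : ℕ) :
    ∃ C : ℝ, 0 < C ∧ ∀ x, ‖x‖ ^ k * ‖F x‖ ≤ C := by
  simpa using F.decay k 0

theorem SchwartzMap.integrable_rpow_mul_norm_sq (F : SchwartzMap Plane ℂ) {p : ℝ} (hp0 : 0 ≤ p)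
    (hp : p ≤ 4) : Integrable fun x : Plane => ‖x‖ ^ p * ‖F x‖ ^ 2 := by
  obtain ⟨C, hC, hF⟩ := F.exists_pow_mul_norm_le 0
  refine ((F.integrable_rpow_mul_norm hp0 hp).const_mul C).mono'
    (by have := F.continuous.measurable; fun_prop) (Filter.Eventually.of_forall fun x => ?_)
  have hFx : ‖F x‖ ≤ C := by simpa using hF x
  rw [Real.norm_of_nonneg (by positivity)]
  calc ‖x‖ ^ p * ‖F x‖ ^ 2 = ‖F x‖ * (‖x‖ ^ p * ‖F x‖) := by ring
    _ ≤ C * (‖x‖ ^ p * ‖F x‖) := by gcongr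

/-- The integrand of the trilinear form. -/
noncomputable def gevreyIntegrand (γ s t : ℝ) (F G : SchwartzMap Plane ℂ) (ξ η : Plane) : ℂ :=
  ((gevreyWeight γ s t ‖ξ‖ ‖ξ - η‖ ‖η‖ * rieszFactor ξ η : ℝ) : ℂ) * G η * F (ξ - η) * F (-ξ)

theorem integrable_gevreyIntegrand {γ s t : ℝ} (hγ0 : 0 ≤ γ) (hγ1 : γ ≤ 1) (hs0 : 0 ≤ s)
    (hs : s ≤ 2) (ht : 0 ≤ t) (F G : SchwartzMap Plane ℂ) :
    Integrable (Function.uncurry (gevreyIntegrand γ s t F G)) (volume.prod volume) := by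
  obtain ⟨C, hC, hF⟩ := F.exists_pow_mul_norm_le 1
  have hF' : Integrable fun ξ : Plane => ‖ξ‖ ^ (2 * s) * ‖F (-ξ)‖ := by
    simpa using (F.integrable_rpow_mul_norm (p := 2 * s) (by linarith) (by linarith)).comp_neg
  refine ((hF'.mul_prod G.integrable.norm).const_mul C).mono' ?_
    (Filter.Eventually.of_forall fun p => ?_)
  · have := F.continuous.measurable
    have := G.continuous.measurable
    have hr := measurable_rieszFactor
    have hw : Measurable fun p : Plane × Plane =>
        gevreyWeight γ s t ‖p.1‖ ‖p.1 - p.2‖ ‖p.2‖ := by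
      unfold gevreyWeight; fun_prop
    have h := Complex.measurable_ofReal.comp (hw.mul hr)
    refine Measurable.aestronglyMeasurable (((h.mul ?_).mul ?_).mul ?_) <;> fun_prop
  · obtain ⟨ξ, η⟩ := p
    simp only [Function.uncurry_apply_pair, gevreyIntegrand, norm_mul, Complex.norm_real,
      Real.norm_eq_abs]
    rw [abs_of_nonneg (gevreyWeight_nonneg (norm_nonneg ξ))]
    have hw : gevreyWeight γ s t ‖ξ‖ ‖ξ - η‖ ‖η‖ ≤ ‖ξ‖ ^ (2 * s) :=
      gevreyWeight_le hγ0 hγ1 ht (norm_nonneg _) (norm_nonneg _) (norm_nonneg _)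
        (norm_le_norm_sub_add ξ η)
    calc gevreyWeight γ s t ‖ξ‖ ‖ξ - η‖ ‖η‖ * |rieszFactor ξ η| * ‖G η‖ * ‖F (ξ - η)‖ * ‖F (-ξ)‖
        ≤ ‖ξ‖ ^ (2 * s) * ‖ξ - η‖ * ‖G η‖ * ‖F (ξ - η)‖ * ‖F (-ξ)‖ := by
          gcongr
          exact abs_rieszFactor_le ξ η
      _ = (‖ξ - η‖ ^ 1 * ‖F (ξ - η)‖) * (‖ξ‖ ^ (2 * s) * ‖F (-ξ)‖ * ‖G η‖) := by ring
      _ ≤ C * (‖ξ‖ ^ (2 * s) * ‖F (-ξ)‖ * ‖G η‖) := by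
          gcongr
          exact hF _

theorem gevreyIntegrand_add_reflect (γ s t : ℝ) (F G : SchwartzMap Plane ℂ) (ξ η : Plane) :
    gevreyIntegrand γ s t F G ξ η + gevreyIntegrand γ s t F G (η - ξ) η =
      ((rieszFactor ξ η * (gevreyWeight γ s t ‖ξ‖ ‖ξ - η‖ ‖η‖ -
        gevreyWeight γ s t ‖ξ - η‖ ‖ξ‖ ‖η‖) : ℝ) : ℂ) * G η * F (ξ - η) * F (-ξ) := by
  unfold gevreyIntegrand
  rw [rieszFactor_sub, show η - ξ - η = -ξ by abel, neg_sub, norm_neg, norm_sub_rev η ξ]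
  push_cast
  ring

theorem norm_gevreyIntegrand_add_reflect_le {γ s t : ℝ} (hγ0 : 0 < γ) (hγ1 : γ < 1)
    (hs : s = 2 - γ) (ht : 0 ≤ t) (F G : SchwartzMap Plane ℂ) {ξ η : Plane}
    (h : ‖ξ - η‖ ≤ ‖ξ‖) :
    ‖gevreyIntegrand γ s t F G ξ η + gevreyIntegrand γ s t F G (η - ξ) η‖ ≤
      gevreyKernel γ t ‖ξ‖ ‖ξ - η‖ ‖η‖ * ((‖η‖ ^ s * ‖G η‖) *
        (‖ξ - η‖ ^ (s + γ / 2) * ‖F (ξ - η)‖) * (‖-ξ‖ ^ (s + γ / 2) * ‖F (-ξ)‖)) := by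
  have hK := gevreyKernel_nonneg (γ := γ) ht (norm_nonneg ξ) (norm_nonneg (ξ - η)) (norm_nonneg η)
  rw [gevreyIntegrand_add_reflect]
  by_cases hr : rieszFactor ξ η = 0
  · rw [hr]
    simp only [zero_mul, Complex.ofReal_zero, norm_zero]
    positivity
  have hη : 0 < ‖η‖ := by
    refine norm_pos_iff.2 fun h0 => hr ?_
    simp [rieszFactor, h0]
  have hb : 0 < ‖ξ - η‖ := (abs_pos.2 hr).trans_le (abs_rieszFactor_le ξ η)
  simp only [norm_mul, Complex.norm_real, Real.norm_eq_abs, norm_neg]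
  calc |rieszFactor ξ η| * |gevreyWeight γ s t ‖ξ‖ ‖ξ - η‖ ‖η‖ -
        gevreyWeight γ s t ‖ξ - η‖ ‖ξ‖ ‖η‖| * ‖G η‖ * ‖F (ξ - η)‖ * ‖F (-ξ)‖
      ≤ ‖ξ - η‖ * |gevreyWeight γ s t ‖ξ‖ ‖ξ - η‖ ‖η‖ -
        gevreyWeight γ s t ‖ξ - η‖ ‖ξ‖ ‖η‖| * ‖G η‖ * ‖F (ξ - η)‖ * ‖F (-ξ)‖ := by
        gcongr
        exact abs_rieszFactor_le ξ η
    _ ≤ ‖η‖ ^ s * (‖ξ - η‖ ^ (s + γ / 2) * ‖ξ‖ ^ (s + γ / 2)) *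
        gevreyKernel γ t ‖ξ‖ ‖ξ - η‖ ‖η‖ * ‖G η‖ * ‖F (ξ - η)‖ * ‖F (-ξ)‖ := by
        gcongr ?_ * _ * _ * _
        exact mul_abs_gevreyWeight_sub_le hγ0 hγ1 hs ht hb hη h (norm_le_norm_sub_add ξ η)
    _ = _ := by ring

theorem enorm_gevreyIntegrand_add_reflect_le {γ s t : ℝ} (hγ0 : 0 < γ) (hγ1 : γ < 1)
    (hs : s = 2 - γ) (ht : 0 ≤ t) (F G : SchwartzMap Plane ℂ) {ξ η : Plane}
    (h : ‖ξ - η‖ ≤ ‖ξ‖) :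
    ‖gevreyIntegrand γ s t F G ξ η + gevreyIntegrand γ s t F G (η - ξ) η‖ₑ ≤
      ENNReal.ofReal (gevreyKernel γ t ‖ξ‖ ‖ξ - η‖ ‖η‖) * (ENNReal.ofReal (‖η‖ ^ s * ‖G η‖) *
        ENNReal.ofReal (‖ξ - η‖ ^ (s + γ / 2) * ‖F (ξ - η)‖) *
        ENNReal.ofReal (‖-ξ‖ ^ (s + γ / 2) * ‖F (-ξ)‖)) := by
  rw [← ENNReal.ofReal_mul (by positivity), ← ENNReal.ofReal_mul (by positivity),
    ← ENNReal.ofReal_mul (gevreyKernel_nonneg ht (norm_nonneg _) (norm_nonneg _) (norm_nonneg _)),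
    ← ofReal_norm]
  exact ENNReal.ofReal_le_ofReal (norm_gevreyIntegrand_add_reflect_le hγ0 hγ1 hs ht F G h)

theorem enorm_integral_le_of_add_reflect_le {H : Plane → ℂ} (hH : Integrable H)
    {P : Plane → ENNReal} (hP : Measurable P) (η : Plane)
    (h : ∀ ξ, ‖H ξ + H (η - ξ)‖ₑ ≤ P ξ + P (η - ξ)) :
    ‖∫ ξ, H ξ‖ₑ ≤ ∫⁻ ξ, P ξ := by
  have hsum : ∫ ξ, (H ξ + H (η - ξ)) = 2 * ∫ ξ, H ξ := by
    rw [integral_add hH (hH.comp_sub_left η), integral_sub_left_eq_self, two_mul]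
  have h2 : 2 * ‖∫ ξ, H ξ‖ₑ ≤ 2 * ∫⁻ ξ, P ξ := by
    calc 2 * ‖∫ ξ, H ξ‖ₑ = ‖∫ ξ, (H ξ + H (η - ξ))‖ₑ := by
          rw [hsum, enorm_mul, ← ofReal_norm (2 : ℂ)]; simp
      _ ≤ ∫⁻ ξ, ‖H ξ + H (η - ξ)‖ₑ := enorm_integral_le_lintegral_enorm _
      _ ≤ ∫⁻ ξ, (P ξ + P (η - ξ)) := lintegral_mono h
      _ = 2 * ∫⁻ ξ, P ξ := by
          rw [lintegral_add_left hP, lintegral_sub_left_eq_self, two_mul]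
  exact (ENNReal.mul_le_mul_iff_right two_ne_zero ENNReal.ofNat_ne_top).1 h2

theorem lintegral_ofReal_rpow_mul_norm_sq (F : SchwartzMap Plane ℂ) {p : ℝ} (hp0 : 0 ≤ p)
    (hp : p ≤ 2) :
    ∫⁻ x : Plane, ENNReal.ofReal (‖x‖ ^ p * ‖F x‖) ^ 2 =
      ENNReal.ofReal (∫ x : Plane, ‖x‖ ^ (2 * p) * ‖F x‖ ^ 2) := by
  rw [ofReal_integral_eq_lintegral_ofReal
    (F.integrable_rpow_mul_norm_sq (by linarith) (by linarith))
    (Filter.Eventually.of_forall fun x => by positivity)]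
  refine lintegral_congr fun x => ?_
  rw [← ENNReal.ofReal_pow (by positivity), mul_pow, ← Real.rpow_mul_natCast (norm_nonneg x),
    Nat.cast_ofNat, mul_comm p]

theorem norm_le_of_enorm_le_ofReal_rpow {z : ℂ} {A X Y p : ℝ} (hA : 0 ≤ A) (hX : 0 ≤ X)
    (hY : 0 ≤ Y) (hp : 0 ≤ p)
    (h : ‖z‖ₑ ≤ ENNReal.ofReal A ^ p * ENNReal.ofReal X ^ p * ENNReal.ofReal Y) :
    ‖z‖ ≤ A ^ p * X ^ p * Y := by
  rwa [ENNReal.ofReal_rpow_of_nonneg hA hp, ENNReal.ofReal_rpow_of_nonneg hX hp,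
    ← ENNReal.ofReal_mul (by positivity), ← ENNReal.ofReal_mul (by positivity), ← ofReal_norm,
    ENNReal.ofReal_le_ofReal_iff (by positivity)] at h

/-- Fourier-side formulation of the key Gevrey commutator estimate (Lemma 3.1, first
inequality): for `0 < γ < 1`, `s = 2 - γ`, the trilinear integral with phase
`e^{-t(|η|^γ + |ξ-η|^γ - |ξ|^γ)}` and Riesz-type coefficient `(η^⊥/|η|)·(ξ-η)` is bounded by
`C ‖g‖_{Ḣ^s} ‖f‖²_{Ḣ^{s+γ/2}}`, uniformly in `t ≥ 0`. -/
theorem gevrey_trilinear_commutator_estimate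
    (γ : ℝ) (hγ0 : 0 < γ) (hγ1 : γ < 1) (s : ℝ) (hs : s = 2 - γ) :
    ∃ C : ℝ, 0 < C ∧
      ∀ t : ℝ, 0 ≤ t →
      ∀ F G : SchwartzMap (EuclideanSpace ℝ (Fin 2)) ℂ,
        ‖∫ ξ : EuclideanSpace ℝ (Fin 2), ∫ η : EuclideanSpace ℝ (Fin 2),
            ((‖ξ‖ ^ (2 * s) * Real.exp (-t * (‖η‖ ^ γ + ‖ξ - η‖ ^ γ - ‖ξ‖ ^ γ)) *
              (if η = 0 then 0 else
                (-(η 1) * ((ξ - η) 0) + η 0 * ((ξ - η) 1)) / ‖η‖) : ℝ) : ℂ) *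
            G η * F (ξ - η) * F (-ξ)‖ ≤
          C * (∫ η : EuclideanSpace ℝ (Fin 2), ‖η‖ ^ (2 * s) * ‖G η‖ ^ 2) ^ ((1 : ℝ) / 2) *
            ∫ ξ : EuclideanSpace ℝ (Fin 2), ‖ξ‖ ^ (2 * (s + γ / 2)) * ‖F ξ‖ ^ 2 := by
  obtain ⟨A, hA0, hA⟩ := exists_lintegral_gevreyKernel_sq_le hγ0 hγ1
  refine ⟨A ^ (1 / 2 : ℝ) + 1, by positivity, fun t ht F G => ?_⟩
  change ‖∫ ξ, ∫ η, gevreyIntegrand γ s t F G ξ η‖ ≤ _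
  set g : EuclideanSpace ℝ (Fin 2) → ENNReal := fun η => ENNReal.ofReal (‖η‖ ^ s * ‖G η‖) with hg
  set f : EuclideanSpace ℝ (Fin 2) → ENNReal :=
    fun ξ => ENNReal.ofReal (‖ξ‖ ^ (s + γ / 2) * ‖F ξ‖) with hf
  set K : EuclideanSpace ℝ (Fin 2) → EuclideanSpace ℝ (Fin 2) → ENNReal :=
    fun ξ η => ENNReal.ofReal (gevreyKernel γ t ‖ξ‖ ‖ξ - η‖ ‖η‖) with hK
  have hKm : Measurable (Function.uncurry K) := measurable_gevreyKernel γ t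
  have hFm := F.continuous.measurable
  have hGm := G.continuous.measurable
  have hgm : Measurable g := by fun_prop
  have hfm : Measurable f := by fun_prop
  have hint := integrable_gevreyIntegrand hγ0.le hγ1.le (by linarith : 0 ≤ s) (by linarith) ht F G
  have hbound : ‖∫ ξ, ∫ η, gevreyIntegrand γ s t F G ξ η‖ₑ ≤
      ∫⁻ η, ∫⁻ ξ, K ξ η * (g η * f (ξ - η) * f (-ξ)) := by
    rw [integral_integral_swap hint]
    refine (enorm_integral_le_lintegral_enorm _).trans (lintegral_mono_ae ?_)
    filter_upwards [hint.prod_left_ae] with η hη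
    have hKη : Measurable fun ξ => K ξ η := hKm.of_uncurry_right
    refine enorm_integral_le_of_add_reflect_le hη (by fun_prop) η fun ξ => ?_
    rcases le_total ‖ξ - η‖ ‖ξ‖ with h | h
    · exact (enorm_gevreyIntegrand_add_reflect_le hγ0 hγ1 hs ht F G h).trans le_self_add
    · have h' : ‖η - ξ - η‖ ≤ ‖η - ξ‖ := by
        rwa [show η - ξ - η = -ξ by abel, norm_neg, norm_sub_rev η ξ]
      have := enorm_gevreyIntegrand_add_reflect_le hγ0 hγ1 hs ht F G h'
      rw [sub_sub_cancel, add_comm] at this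
      exact this.trans le_add_self
  have hX : 0 ≤ ∫ η : EuclideanSpace ℝ (Fin 2), ‖η‖ ^ (2 * s) * ‖G η‖ ^ 2 :=
    integral_nonneg fun η => by positivity
  have hY : 0 ≤ ∫ ξ : EuclideanSpace ℝ (Fin 2), ‖ξ‖ ^ (2 * (s + γ / 2)) * ‖F ξ‖ ^ 2 :=
    integral_nonneg fun ξ => by positivity
  have htri := hbound.trans (lintegral_trilinear_le hKm hfm hgm (hA t ht))
  rw [lintegral_ofReal_rpow_mul_norm_sq G (by linarith) (by linarith),
    lintegral_ofReal_rpow_mul_norm_sq F (by linarith) (by linarith)] at htri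
  refine (norm_le_of_enorm_le_ofReal_rpow hA0 hX hY (by norm_num) htri).trans ?_
  exact mul_le_mul_of_nonneg_right (mul_le_mul_of_nonneg_right (lt_add_one _).le
    (Real.rpow_nonneg hX _)) hY
end
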